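/- arXiv:1909.09379 — 2 statements merged into one kernel-verified Lean document; each statement's English description precedes it below -/
import Mathlib

section
/- Assume (P₂) and (Q₂). Let {u_n} be a bounded sequence in W^{s,p(·,·)}(ℝ^N) such that u_n ⇀ u weakly in W^{s,p(·,·)}(ℝ^N), the functions U_n(x) := |u_n(x)|^{p̄} + ∫_{ℝ^N} |u_n(x)−u_n(y)|^{p(x,y)}/|x−y|^{N+s·p(x,y)} dy converge weakly-* to a finite Radon measure μ, and |u_n|^{q(x)} converges weakly-* to a finite Radon measure ν. Define ν_∞ := lim_{R→∞} limsup_{n→∞} ∫_{|x|>R} |u_n|^{q(x)} dx and μ_∞ := lim_{R→∞} limsup_{n→∞} ∫_{|x|>R} U_n(x) dx. Then limsup_{n→∞} ∫_{ℝ^N} |u_n|^{q(x)} dx = ν(ℝ^N) + ν_∞ and limsup_{n→∞} ∫_{ℝ^N} U_n(x) dx = μ(ℝ^N) + μ_∞. -/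
open MeasureTheory Filter Topology Set
open scoped ENNReal NNReal

noncomputable section

/-- Euclidean space `ℝ^N`. -/
abbrev Euc (N : ℕ) := EuclideanSpace ℝ (Fin N)

/-- The modular of the variable exponent Lebesgue space `L^{h(·)}_μ`. -/
def varModular {α : Type*} [MeasurableSpace α] (μ : Measure α) (h : α → ℝ) (u : α → ℝ) : ℝ≥0∞ :=
  ∫⁻ x, ENNReal.ofReal (|u x| ^ (h x)) ∂μ

/-- The Luxemburg norm on the variable exponent Lebesgue space `L^{h(·)}_μ`. -/
def luxNorm {α : Type*} [MeasurableSpace α] (μ : Measure α) (h : α → ℝ) (u : α → ℝ) : ℝ :=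
  sInf {c : ℝ | 0 < c ∧ varModular μ h (fun x => u x / c) ≤ 1}

/-- Membership in the variable exponent Lebesgue space `L^{h(·)}_μ`. -/
def MemVarLp {α : Type*} [MeasurableSpace α] (μ : Measure α) (h : α → ℝ) (u : α → ℝ) : Prop :=
  AEStronglyMeasurable u μ ∧ varModular μ h u < ⊤

/-- The integrand of the Gagliardo-type seminorm with variable exponent. -/
def sobKernel {N : ℕ} (s : ℝ) (p : Euc N → Euc N → ℝ) (u : Euc N → ℝ) (x y : Euc N) : ℝ≥0∞ :=
  ENNReal.ofReal (|u x - u y| ^ (p x y) / dist x y ^ ((N : ℝ) + s * p x y))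

/-- The modular of the fractional Sobolev space `W^{s,p(·,·)}(Ω)`. -/
def sobModular {N : ℕ} (Ω : Set (Euc N)) (s : ℝ) (p : Euc N → Euc N → ℝ)
    (u : Euc N → ℝ) : ℝ≥0∞ :=
  (∫⁻ x in Ω, ENNReal.ofReal (|u x| ^ (p x x))) + ∫⁻ x in Ω, ∫⁻ y in Ω, sobKernel s p u x y

/-- The Luxemburg-type norm of the fractional Sobolev space `W^{s,p(·,·)}(Ω)`. -/
def sobNorm {N : ℕ} (Ω : Set (Euc N)) (s : ℝ) (p : Euc N → Euc N → ℝ) (u : Euc N → ℝ) : ℝ :=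
  sInf {c : ℝ | 0 < c ∧ sobModular Ω s p (fun x => u x / c) ≤ 1}

/-- Membership in the fractional Sobolev space `W^{s,p(·,·)}(Ω)`. -/
def MemSob {N : ℕ} (Ω : Set (Euc N)) (s : ℝ) (p : Euc N → Euc N → ℝ) (u : Euc N → ℝ) : Prop :=
  AEStronglyMeasurable u (volume.restrict Ω) ∧ sobModular Ω s p u < ⊤

/-- A bounded linear functional on `W^{s,p(·,·)}(ℝ^N)`, described by its action on functions. -/
def IsBddLinFunc {N : ℕ} (s : ℝ) (p : Euc N → Euc N → ℝ) (T : (Euc N → ℝ) → ℝ) : Prop :=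
  (∀ f g : Euc N → ℝ, MemSob Set.univ s p f → MemSob Set.univ s p g →
      T (f + g) = T f + T g) ∧
  (∀ (c : ℝ) (f : Euc N → ℝ), MemSob Set.univ s p f → T (c • f) = c * T f) ∧
  ∃ C : ℝ, ∀ f : Euc N → ℝ, MemSob Set.univ s p f → |T f| ≤ C * sobNorm Set.univ s p f

/-- Weak convergence in `W^{s,p(·,·)}(ℝ^N)`. -/
def WeakConvSob {N : ℕ} (s : ℝ) (p : Euc N → Euc N → ℝ)
    (un : ℕ → Euc N → ℝ) (u : Euc N → ℝ) : Prop :=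
  ∀ T : (Euc N → ℝ) → ℝ, IsBddLinFunc s p T →
    Tendsto (fun n => T (un n)) atTop (𝓝 (T u))

/-- Weak-* convergence of a sequence of integrable functions to a finite Radon measure:
testing against continuous functions vanishing at infinity. -/
def WeakStarConv {N : ℕ} (f : ℕ → Euc N → ℝ) (μ : Measure (Euc N)) : Prop :=
  ∀ φ : Euc N → ℝ, Continuous φ → Tendsto φ (cocompact (Euc N)) (𝓝 0) →
    Tendsto (fun n => ∫ x, φ x * f n x) atTop (𝓝 (∫ x, φ x ∂μ))

/-- `U(x) = |u(x)|^{p̄} + ∫_{ℝ^N} |u(x)-u(y)|^{p(x,y)} / |x-y|^{N+s·p(x,y)} dy`. -/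
def Ufun {N : ℕ} (s : ℝ) (p : Euc N → Euc N → ℝ) (pbar : ℝ) (u : Euc N → ℝ) (x : Euc N) : ℝ :=
  |u x| ^ pbar + (∫⁻ y, sobKernel s p u x y).toReal


def cutR {N : ℕ} (R : ℝ) (x : Euc N) : ℝ := max 0 (min 1 (R + 1 - ‖x‖))

lemma cutR_cont {N : ℕ} (R : ℝ) : Continuous (cutR R : Euc N → ℝ) := by
  unfold cutR; fun_prop

lemma cutR_nonneg {N : ℕ} (R : ℝ) (x : Euc N) : 0 ≤ cutR R x := le_max_left _ _

lemma cutR_le_one {N : ℕ} (R : ℝ) (x : Euc N) : cutR R x ≤ 1 :=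
  max_le zero_le_one (min_le_left _ _)

lemma cutR_eq_one {N : ℕ} {R : ℝ} {x : Euc N} (h : ‖x‖ ≤ R) : cutR R x = 1 := by
  unfold cutR
  rw [min_eq_left (by linarith), max_eq_right zero_le_one]

lemma cutR_eq_zero {N : ℕ} {R : ℝ} {x : Euc N} (h : R + 1 ≤ ‖x‖) : cutR R x = 0 := by
  unfold cutR
  apply max_eq_left
  exact (min_le_right _ _).trans (by linarith)

lemma cutR_tendsto {N : ℕ} (R : ℝ) : Tendsto (cutR R : Euc N → ℝ) (cocompact _) (𝓝 0) := by
  apply tendsto_const_nhds.congr'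
  filter_upwards [(tendsto_norm_cocompact_atTop (E := Euc N)).eventually_ge_atTop (R + 1)] with x hx
  exact (cutR_eq_zero hx).symm

lemma cutR_lim {N : ℕ} (x : Euc N) : Tendsto (fun R => cutR R x) atTop (𝓝 1) := by
  apply tendsto_const_nhds.congr'
  filter_upwards [eventually_ge_atTop ‖x‖] with R hR
  exact (cutR_eq_one hR).symm

lemma cutR_int {N : ℕ} (f : Euc N → ℝ) (m : Measure (Euc N)) (hf : Integrable f m) (R : ℝ) :
    Integrable (fun x => cutR R x * f x) m := by
  refine hf.bdd_mul (c := 1) (cutR_cont R).aestronglyMeasurable (ae_of_all _ fun x => ?_)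
  rw [Real.norm_of_nonneg (cutR_nonneg R x)]; exact cutR_le_one R x

lemma cutR_int_lim {N : ℕ} (f : Euc N → ℝ) (m : Measure (Euc N)) (hf : Integrable f m) :
    Tendsto (fun R => ∫ x, cutR R x * f x ∂m) atTop (𝓝 (∫ x, f x ∂m)) := by
  refine tendsto_integral_filter_of_dominated_convergence (fun x => ‖f x‖)
    (Eventually.of_forall fun R => (cutR_int f m hf R).aestronglyMeasurable)
    (Eventually.of_forall fun R => ae_of_all _ fun x => ?_) hf.norm (ae_of_all _ fun x => ?_)
  · rw [norm_mul, Real.norm_of_nonneg (cutR_nonneg R x)]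
    exact mul_le_of_le_one_left (norm_nonneg _) (cutR_le_one R x)
  · simpa using (cutR_lim x).mul_const (f x)

open ZeroAtInfty in
lemma C0_int {N : ℕ} (f : Euc N → ℝ) (hf : Integrable f) (φ : C₀(Euc N, ℝ)) :
    Integrable (fun x => φ x * f x) := by
  refine hf.bdd_mul (c := ‖φ‖) (map_continuous φ).aestronglyMeasurable (ae_of_all _ fun x => ?_)
  exact φ.toBCF.norm_coe_le_norm x

open ZeroAtInfty in
def C0func {N : ℕ} (f : Euc N → ℝ) (hf : Integrable f) : C₀(Euc N, ℝ) →L[ℝ] ℝ :=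
  LinearMap.mkContinuous
    { toFun := fun φ => ∫ x, φ x * f x
      map_add' := fun φ ψ => by
        simp only [ZeroAtInftyContinuousMap.add_apply, add_mul]
        exact integral_add (C0_int f hf φ) (C0_int f hf ψ)
      map_smul' := fun c φ => by
        simp only [ZeroAtInftyContinuousMap.smul_apply, smul_eq_mul, mul_assoc, RingHom.id_apply]
        exact integral_const_mul _ _ }
    (∫ x, ‖f x‖) (fun φ => by
      simp only [LinearMap.coe_mk, AddHom.coe_mk]
      refine (norm_integral_le_integral_norm _).trans ?_
      rw [mul_comm, ← integral_const_mul]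
      refine integral_mono (C0_int f hf φ).norm (hf.norm.const_mul _) (fun x => ?_)
      simp only [norm_mul]
      gcongr
      exact φ.toBCF.norm_coe_le_norm x)

open ZeroAtInfty in
lemma mass_bdd {N : ℕ} (f : ℕ → Euc N → ℝ) (m : Measure (Euc N))
    (hint : ∀ n, Integrable (f n)) (h : WeakStarConv f m) :
    ∃ C, ∀ n, ∫ x, f n x ≤ C := by
  have hb : ∃ C', ∀ n, ‖C0func (f n) (hint n)‖ ≤ C' := by
    apply banach_steinhaus
    intro φ
    have h1 := h φ (map_continuous φ) φ.zero_at_infty'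
    obtain ⟨C, hC⟩ := h1.norm.bddAbove_range
    exact ⟨C, fun n => hC ⟨n, rfl⟩⟩
  obtain ⟨C, hC⟩ := hb
  refine ⟨C, fun n => ?_⟩
  refine le_of_tendsto (cutR_int_lim (f n) volume (hint n)) (Eventually.of_forall fun R => ?_)
  let φ : C₀(Euc N, ℝ) := ⟨⟨cutR R, cutR_cont R⟩, cutR_tendsto R⟩
  have h2 : C0func (f n) (hint n) φ = ∫ x, cutR R x * f n x := rfl
  have h3 : ‖φ‖ ≤ 1 := by
    rw [← ZeroAtInftyContinuousMap.norm_toBCF_eq_norm, BoundedContinuousFunction.norm_le zero_le_one]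
    intro x
    change ‖cutR R x‖ ≤ 1
    rw [Real.norm_of_nonneg (cutR_nonneg R x)]; exact cutR_le_one R x
  calc _ = C0func (f n) (hint n) φ := h2.symm
    _ ≤ ‖C0func (f n) (hint n) φ‖ := le_abs_self _
    _ ≤ ‖C0func (f n) (hint n)‖ * ‖φ‖ := ContinuousLinearMap.le_opNorm _ _
    _ ≤ ‖C0func (f n) (hint n)‖ * 1 := by gcongr
    _ ≤ C := by simpa using hC n

lemma limsup_add_tendsto (b c : ℕ → ℝ) (β C : ℝ) (hb : Tendsto b atTop (𝓝 β))
    (h0 : ∀ n, 0 ≤ c n) (hC : ∀ n, c n ≤ C) :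
    limsup (fun n => b n + c n) atTop = β + limsup c atTop := by
  have hca : IsBoundedUnder (· ≤ ·) atTop c := isBoundedUnder_of ⟨C, hC⟩
  have hcb : IsBoundedUnder (· ≥ ·) atTop c := isBoundedUnder_of ⟨0, h0⟩
  have hba := hb.isBoundedUnder_le
  have hbb := hb.isBoundedUnder_ge
  apply le_antisymm
  · have := limsup_add_le (u := b) (v := c) (f := atTop) hbb hba hcb.isCoboundedUnder_le hca
    rw [hb.limsup_eq] at this
    exact this
  · have := le_limsup_add (u := c) (v := b) (f := atTop) hca hcb.isCoboundedUnder_le hba hbb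
    rw [hb.liminf_eq, add_comm, add_comm c] at this
    exact this

lemma mass_split {N : ℕ} (f : ℕ → Euc N → ℝ) (m : Measure (Euc N)) [IsFiniteMeasure m]
    (hint : ∀ n, Integrable (f n)) (hnn : ∀ n x, 0 ≤ f n x) (h : WeakStarConv f m) :
    ∃ L : ℝ, Tendsto (fun R : ℝ => limsup (fun n => ∫ x in {x : Euc N | R < ‖x‖}, f n x) atTop)
        atTop (𝓝 L) ∧
      limsup (fun n => ∫ x, f n x) atTop = (m Set.univ).toReal + L := by
  obtain ⟨C, hC⟩ := mass_bdd f m hint h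
  have hms : ∀ R : ℝ, MeasurableSet {x : Euc N | R < ‖x‖} := fun R =>
    measurableSet_lt measurable_const measurable_norm
  have htl : ∀ R n, ∫ x in {x : Euc N | R < ‖x‖}, f n x ≤ C := fun R n =>
    (setIntegral_le_integral (hint n) (ae_of_all _ (hnn n))).trans (hC n)
  have htl0 : ∀ R n, 0 ≤ ∫ x in {x : Euc N | R < ‖x‖}, f n x := fun R n =>
    integral_nonneg (hnn n)
  have hcut : ∀ R n, Integrable (fun x => (1 - cutR R x) * f n x) := fun R n => by
    simp only [sub_mul, one_mul]
    exact (hint n).sub (cutR_int _ _ (hint n) R)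
  have hlem : ∀ a b : ℕ → ℝ, (∀ n, 0 ≤ a n) → (∀ n, a n ≤ b n) → (∀ n, b n ≤ C) →
      limsup a atTop ≤ limsup b atTop := fun a b h0 hab hbC =>
    limsup_le_limsup (Eventually.of_forall hab)
      (isBoundedUnder_of ⟨0, h0⟩ : IsBoundedUnder (· ≥ ·) atTop a).isCoboundedUnder_le
      (isBoundedUnder_of ⟨C, hbC⟩)
  set T : ℝ → ℝ := fun R => limsup (fun n => ∫ x in {x : Euc N | R < ‖x‖}, f n x) atTop with hT
  have hanti : Antitone T := fun R R' hRR => by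
    refine hlem _ _ (htl0 R') (fun n => ?_) (htl R)
    refine setIntegral_mono_set (hint n).integrableOn (ae_of_all _ (hnn n)) ?_
    exact Eventually.of_forall (fun x hx => lt_of_le_of_lt hRR hx)
  have hT0 : ∀ R, 0 ≤ T R := fun R => by
    have := hlem (fun _ => 0) _ (fun _ => le_rfl) (htl0 R) (htl R)
    simpa using this
  have hlim := tendsto_atTop_ciInf hanti ⟨0, by rintro _ ⟨R, rfl⟩; exact hT0 R⟩
  refine ⟨_, hlim, ?_⟩
  set L := ⨅ R, T R
  set W : ℝ → ℝ := fun R => limsup (fun n => ∫ x, (1 - cutR R x) * f n x) atTop with hW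
  have hWC : ∀ R n, ∫ x, (1 - cutR R x) * f n x ≤ ∫ x, f n x := fun R n => by
    refine integral_mono (hcut R n) (hint n) fun x => ?_
    exact mul_le_of_le_one_left (hnn n x) (by linarith [cutR_nonneg R x])
  have hW0 : ∀ R n, 0 ≤ ∫ x, (1 - cutR R x) * f n x := fun R n =>
    integral_nonneg fun x => mul_nonneg (by linarith [cutR_le_one R x]) (hnn n x)
  have hWT : ∀ R, W R ≤ T R := fun R => by
    refine hlem _ _ (hW0 R) (fun n => ?_) (htl R)
    rw [← integral_indicator (hms R)]
    refine integral_mono (hcut R n) ((hint n).indicator (hms R)) fun x => ?_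
    by_cases hx : R < ‖x‖
    · rw [indicator_of_mem (show x ∈ {x : Euc N | R < ‖x‖} from hx)]
      exact mul_le_of_le_one_left (hnn n x) (by linarith [cutR_nonneg R x])
    · rw [indicator_of_notMem (show x ∉ {x : Euc N | R < ‖x‖} from hx)]
      simp [cutR_eq_one (not_lt.1 hx)]
  have hTW : ∀ R, T (R + 1) ≤ W R := fun R => by
    refine hlem _ _ (htl0 _) (fun n => ?_) (fun n => (hWC R n).trans (hC n))
    rw [← integral_indicator (hms _)]
    refine integral_mono ((hint n).indicator (hms _)) (hcut R n) fun x => ?_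
    by_cases hx : R + 1 < ‖x‖
    · rw [indicator_of_mem (show x ∈ {x : Euc N | R + 1 < ‖x‖} from hx)]
      simp [cutR_eq_zero hx.le]
    · rw [indicator_of_notMem (show x ∉ {x : Euc N | R + 1 < ‖x‖} from hx)]
      exact mul_nonneg (by linarith [cutR_le_one R x]) (hnn n x)
  have hWlim : Tendsto W atTop (𝓝 L) :=
    tendsto_of_tendsto_of_tendsto_of_le_of_le
      (hlim.comp (tendsto_atTop_add_const_right _ 1 tendsto_id)) hlim hTW hWT
  have heq : ∀ R, limsup (fun n => ∫ x, f n x) atTop = (∫ x, cutR R x ∂m) + W R := fun R => by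
    rw [← limsup_add_tendsto _ _ _ C (h (cutR R) (cutR_cont R) (cutR_tendsto R)) (hW0 R)
      (fun n => (hWC R n).trans (hC n))]
    congr 1
    ext n
    rw [← integral_add (cutR_int _ _ (hint n) R) (hcut R n)]
    congr 1
    ext x
    ring
  have hm := cutR_int_lim (fun _ => (1:ℝ)) m (integrable_const _)
  simp only [mul_one, integral_const, smul_eq_mul] at hm
  have := hm.add hWlim
  simp only [← heq] at this
  exact tendsto_nhds_unique tendsto_const_nhds this

lemma sobKernel_aemeas {N : ℕ} (s : ℝ) (p : Euc N → Euc N → ℝ)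
    (hp : Continuous fun z : Euc N × Euc N => p z.1 z.2) (u : Euc N → ℝ)
    (hu : AEMeasurable u) :
    AEMeasurable (fun z : Euc N × Euc N => sobKernel s p u z.1 z.2)
      ((volume : Measure (Euc N)).prod (volume : Measure (Euc N))) := by
  have h1 : AEMeasurable (fun z : Euc N × Euc N => u z.1)
      ((volume : Measure (Euc N)).prod (volume : Measure (Euc N))) :=
    hu.comp_quasiMeasurePreserving Measure.quasiMeasurePreserving_fst
  have h2 : AEMeasurable (fun z : Euc N × Euc N => u z.2)
      ((volume : Measure (Euc N)).prod (volume : Measure (Euc N))) :=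
    hu.comp_quasiMeasurePreserving Measure.quasiMeasurePreserving_snd
  have h3 : Measurable (fun z : Euc N × Euc N => p z.1 z.2) := hp.measurable
  have h4 : Measurable (fun z : Euc N × Euc N => dist z.1 z.2) := by fun_prop
  unfold sobKernel
  apply AEMeasurable.ennreal_ofReal
  apply AEMeasurable.div
  · exact AEMeasurable.pow (continuous_abs.measurable.comp_aemeasurable (h1.sub h2)) h3.aemeasurable
  · exact AEMeasurable.pow h4.aemeasurable ((h3.const_mul s).const_add _).aemeasurable

lemma sobKernel_aemeas_right {N : ℕ} (s : ℝ) (p : Euc N → Euc N → ℝ)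
    (hp : Continuous fun z : Euc N × Euc N => p z.1 z.2) (u : Euc N → ℝ)
    (hu : AEMeasurable u) (x : Euc N) :
    AEMeasurable (fun y : Euc N => sobKernel s p u x y) := by
  have h3 : Measurable (fun y : Euc N => p x y) :=
    (hp.comp (by fun_prop : Continuous fun y : Euc N => (x, y))).measurable
  have h4 : Measurable (fun y : Euc N => dist x y) := by fun_prop
  unfold sobKernel
  apply AEMeasurable.ennreal_ofReal
  apply AEMeasurable.div
  · exact AEMeasurable.pow (continuous_abs.measurable.comp_aemeasurable (hu.const_sub _))
      h3.aemeasurable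
  · exact AEMeasurable.pow h4.aemeasurable ((h3.const_mul s).const_add _).aemeasurable

lemma arith1 (A b V P pb θ : ℝ) (hA : 0 < A) (hb : 0 < b) (hV : 0 < V) (hP : pb + P * θ = P) :
    (2 * b) ^ P = 2 ^ P * (2 / V) * (2 / V) ^ θ * A ^ θ *
      (b ^ pb / ((2 * A * b ^ (-P) / V) * (2 * A * b ^ (-P) / V) ^ θ) * (A * b ^ (-P))) := by
  have e : 2 * A * b ^ (-P) / V = (2 / V) * A * b ^ (-P) := by ring
  have h1 : 0 < b ^ (-P) := Real.rpow_pos_of_pos hb _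
  rw [e, Real.mul_rpow (by positivity) h1.le, Real.mul_rpow (by positivity) hA.le,
    ← Real.rpow_mul hb.le, Real.mul_rpow (by norm_num) hb.le]
  have h2 : b ^ P = b ^ pb / b ^ (-P * θ) := by
    rw [← Real.rpow_sub hb]; congr 1; linarith
  rw [h2]
  have := Real.rpow_pos_of_pos hb (-P * θ)
  have := Real.rpow_pos_of_pos hA θ
  have : 0 < (2 / V) ^ θ := Real.rpow_pos_of_pos (by positivity) θ
  field_simp

lemma sob_point {N : ℕ} (hN : 0 < N) (s pb P θ ε₀ V : ℝ) (hε : 0 < ε₀) (hpb : 0 < pb) (hs : 0 < s)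
    (hPpos : 0 < P) (hθ : θ = s * pb / N) (hP : pb + P * θ = P)
    (hV : 0 < V) (hVv : volume (Metric.ball (0 : Euc N) 1) = ENNReal.ofReal V)
    (p : Euc N → Euc N → ℝ)
    (hp : Continuous fun z : Euc N × Euc N => p z.1 z.2)
    (hdiag : ∀ x y : Euc N, dist x y < ε₀ → p x y = pb)
    (u v : Euc N → ℝ) (hu : AEMeasurable u) (hv : AEMeasurable v)
    (huv : ∀ x y, |v x - v y| ≤ |u x - u y|) (hv0 : ∀ x, 0 ≤ v x)
    (A : ℝ) (hA : 0 < A) (hAv : ∫⁻ x, ENNReal.ofReal (v x ^ P) ≤ ENNReal.ofReal A) (x : Euc N) :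
    ENNReal.ofReal (v x ^ P) ≤ ENNReal.ofReal (A ^ θ) *
      (ENNReal.ofReal (2 ^ P * (2 / V) * (2 / V) ^ θ) * (∫⁻ y, sobKernel s p u x y) +
       ENNReal.ofReal ((2 ^ P * (2 / V) / ε₀ ^ N) ^ θ) * ENNReal.ofReal (v x ^ pb)) := by
  have hNr : (0:ℝ) < N := by exact_mod_cast hN
  have hθ0 : 0 < θ := by rw [hθ]; positivity
  rcases (hv0 x).eq_or_lt with h0 | ha
  · rw [← h0, Real.zero_rpow hPpos.ne']; simp
  set b := v x / 2 with hb
  have hb0 : 0 < b := by positivity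
  have hvb : v x = 2 * b := by rw [hb]; ring
  set t := 2 * A * b ^ (-P) / V with ht
  have hbP : 0 < b ^ (-P) := Real.rpow_pos_of_pos hb0 _
  have ht0 : 0 < t := by positivity
  set r := t ^ ((N:ℝ)⁻¹) with hr
  have hr0 : 0 < r := Real.rpow_pos_of_pos ht0 _
  have hrN : r ^ N = t := Real.rpow_inv_natCast_pow ht0.le hN.ne'
  rw [mul_add]
  by_cases hrε : r < ε₀
  · refine le_trans ?_ le_self_add
    -- measure of the ball
    have : Nonempty (Fin N) := ⟨⟨0, hN⟩⟩
    have hball : volume (Metric.ball x r) = ENNReal.ofReal (t * V) := by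
      rw [Measure.addHaar_ball _ _ hr0.le, hVv, finrank_euclideanSpace_fin, hrN,
        ENNReal.ofReal_mul ht0.le]
    have htV : t * V = A * b ^ (-P) + A * b ^ (-P) := by rw [ht]; field_simp; ring
    -- Markov
    have hmark : volume {y | ENNReal.ofReal (b ^ P) ≤ ENNReal.ofReal (v y ^ P)}
        ≤ ENNReal.ofReal (A * b ^ (-P)) := by
      have h1 := (mul_meas_ge_le_lintegral₀ (μ := volume)
        (f := fun y => ENNReal.ofReal (v y ^ P)) (hv.pow_const P).ennreal_ofReal
        (ENNReal.ofReal (b ^ P))).trans hAv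
      have hbp : 0 < b ^ P := Real.rpow_pos_of_pos hb0 _
      rw [mul_comm, ← ENNReal.le_div_iff_mul_le (Or.inl (by simpa using hbp)) (Or.inl (by simp)),
        ← ENNReal.ofReal_div_of_pos hbp] at h1
      rwa [Real.rpow_neg hb0.le, ← div_eq_mul_inv]
    set κ := b ^ pb / (t * t ^ θ) with hκ
    have hκ0 : 0 ≤ κ := by have := Real.rpow_pos_of_pos hb0 pb; positivity
    have hrr : r ^ ((N:ℝ) + s * pb) = t * t ^ θ := by
      rw [hr, ← Real.rpow_mul ht0.le, hθ]
      have : (N:ℝ)⁻¹ * (N + s * pb) = 1 + s * pb / N := by field_simp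
      rw [this, Real.rpow_add ht0, Real.rpow_one]
    have hsub : Metric.ball x r ⊆ {y | ENNReal.ofReal (b ^ P) ≤ ENNReal.ofReal (v y ^ P)} ∪
        {y | ENNReal.ofReal κ ≤ sobKernel s p u x y} := by
      intro y hy
      by_cases hvy : b ≤ v y
      · left
        exact ENNReal.ofReal_le_ofReal (Real.rpow_le_rpow hb0.le hvy hPpos.le)
      · right
        push Not at hvy
        have hd : dist x y < r := by rwa [dist_comm]
        have hd0 : 0 < dist x y := by
          apply dist_pos.2
          rintro rfl
          linarith
        change _ ≤ sobKernel s p u x y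
        unfold sobKernel
        rw [hdiag x y (hd.trans hrε)]
        apply ENNReal.ofReal_le_ofReal
        rw [hκ, ← hrr]
        have : b ≤ |u x - u y| := by
          refine le_trans ?_ (huv x y)
          refine le_trans ?_ (le_abs_self _)
          linarith
        gcongr
    have hmeas : ENNReal.ofReal (A * b ^ (-P)) ≤
        volume {y | ENNReal.ofReal κ ≤ sobKernel s p u x y} := by
      have h1 := (measure_mono (μ := volume) hsub).trans (measure_union_le _ _)
      rw [hball, htV, ENNReal.ofReal_add (by positivity) (by positivity)] at h1
      have h2 := h1.trans (add_le_add_left hmark _)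
      exact (ENNReal.add_le_add_iff_left ENNReal.ofReal_ne_top).1 h2
    have hD := mul_meas_ge_le_lintegral₀ (μ := volume) (sobKernel_aemeas_right s p hp u hu x)
      (ENNReal.ofReal κ)
    have hD2 : ENNReal.ofReal (κ * (A * b ^ (-P))) ≤ ∫⁻ y, sobKernel s p u x y := by
      rw [ENNReal.ofReal_mul hκ0]
      exact (mul_le_mul_right hmeas _).trans hD
    have hAθ : 0 ≤ A ^ θ := Real.rpow_nonneg hA.le _
    have hK : 0 ≤ 2 ^ P * (2 / V) * (2 / V) ^ θ := by positivity
    calc ENNReal.ofReal (v x ^ P)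
        = ENNReal.ofReal (A ^ θ * (2 ^ P * (2 / V) * (2 / V) ^ θ * (κ * (A * b ^ (-P))))) := by
          rw [hvb, arith1 A b V P pb θ hA hb0 hV hP]; congr 1; rw [hκ, ht]; ring
      _ = ENNReal.ofReal (A ^ θ) * (ENNReal.ofReal (2 ^ P * (2 / V) * (2 / V) ^ θ) *
          ENNReal.ofReal (κ * (A * b ^ (-P)))) := by
          rw [ENNReal.ofReal_mul hAθ, ENNReal.ofReal_mul hK]
      _ ≤ _ := by gcongr
  · refine le_trans ?_ le_add_self
    push Not at hrε
    have hrN2 : ε₀ ^ N ≤ t := by rw [← hrN]; gcongr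
    have hεN : 0 < ε₀ ^ N := by positivity
    have hbp : 0 < b ^ P := Real.rpow_pos_of_pos hb0 _
    have h1 : v x ^ P ≤ (2 ^ P * (2 / V) / ε₀ ^ N) * A := by
      rw [hvb, Real.mul_rpow (by norm_num) hb0.le]
      have h2 : b ^ P * ε₀ ^ N ≤ 2 * A / V := by
        calc b ^ P * ε₀ ^ N ≤ b ^ P * t := by gcongr
          _ = 2 * A / V := by rw [ht, Real.rpow_neg hb0.le]; field_simp
      have h3 : b ^ P ≤ 2 * A / V / ε₀ ^ N := by rwa [le_div_iff₀ hεN]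
      calc 2 ^ P * b ^ P ≤ 2 ^ P * (2 * A / V / ε₀ ^ N) := by gcongr
        _ = _ := by ring
    have h4 : v x ^ P = v x ^ pb * (v x ^ P) ^ θ := by
      rw [← Real.rpow_mul ha.le, ← Real.rpow_add ha, hP]
    have hvP := Real.rpow_nonneg ha.le P
    have hvp := Real.rpow_nonneg ha.le pb
    rw [← ENNReal.ofReal_mul (by positivity), ← ENNReal.ofReal_mul (by positivity)]
    apply ENNReal.ofReal_le_ofReal
    calc v x ^ P = v x ^ pb * (v x ^ P) ^ θ := h4
      _ ≤ v x ^ pb * ((2 ^ P * (2 / V) / ε₀ ^ N) * A) ^ θ := by gcongr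
      _ = _ := by rw [Real.mul_rpow (by positivity) hA.le]; ring

lemma sob_embed {N : ℕ} (hN : 0 < N) (s pb P ε₀ : ℝ) (hε : 0 < ε₀) (hpb : 0 < pb) (hs : 0 < s)
    (hsp : s * pb < N) (hP : P = N * pb / (N - s * pb))
    (p : Euc N → Euc N → ℝ)
    (hp : Continuous fun z : Euc N × Euc N => p z.1 z.2)
    (hdiag : ∀ x y : Euc N, dist x y < ε₀ → p x y = pb)
    (u : Euc N → ℝ) (hu : AEMeasurable u)
    (h1 : ∫⁻ x, ENNReal.ofReal (|u x| ^ pb) < ⊤)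
    (h2 : ∫⁻ x, ∫⁻ y, sobKernel s p u x y < ⊤) :
    ∫⁻ x, ENNReal.ofReal (|u x| ^ P) < ⊤ := by
  have hNr : (0:ℝ) < N := by exact_mod_cast hN
  obtain ⟨θ, hθ⟩ : ∃ θ : ℝ, θ = s * pb / N := ⟨_, rfl⟩
  have hd : 0 < N - s * pb := by linarith
  have hPpos : 0 < P := by rw [hP]; positivity
  have hPθ : pb + P * θ = P := by
    have e : P * (N - s * pb) = N * pb := by rw [hP]; exact div_mul_cancel₀ _ hd.ne'
    have e2 : θ * N = s * pb := by rw [hθ]; exact div_mul_cancel₀ _ hNr.ne'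
    apply mul_right_cancel₀ hNr.ne'
    linear_combination P * e2 - e
  have hθ0 : 0 < θ := by rw [hθ]; positivity
  have hθ1 : θ < 1 := by rw [hθ, div_lt_one hNr]; exact hsp
  have hpP : pb ≤ P := by nlinarith
  obtain ⟨V, hV⟩ : ∃ V : ℝ, V = (volume (Metric.ball (0 : Euc N) 1)).toReal := ⟨_, rfl⟩
  have hfin : volume (Metric.ball (0 : Euc N) 1) ≠ ⊤ := measure_ball_lt_top.ne
  have hVv : volume (Metric.ball (0 : Euc N) 1) = ENNReal.ofReal V := by
    rw [hV, ENNReal.ofReal_toReal hfin]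
  have hV0 : 0 < V := by
    rw [hV]; exact ENNReal.toReal_pos (Metric.measure_ball_pos _ _ one_pos).ne' hfin
  set v : ℕ → Euc N → ℝ := fun k x => min |u x| k with hvdef
  have hv0 : ∀ k x, 0 ≤ v k x := fun k x => le_min (abs_nonneg _) (Nat.cast_nonneg _)
  have hvm : ∀ k, AEMeasurable (v k) := fun k =>
    (continuous_abs.measurable.comp_aemeasurable hu).min aemeasurable_const
  have hvu : ∀ k x, v k x ≤ |u x| := fun k x => min_le_left _ _
  have hvv : ∀ k x y, |v k x - v k y| ≤ |u x - u y| := fun k x y =>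
    (abs_min_sub_min_le_max _ _ _ _).trans (by
      simpa using abs_abs_sub_abs_le_abs_sub (u x) (u y))
  set M : ℝ≥0∞ := ENNReal.ofReal (2 ^ P * (2 / V) * (2 / V) ^ θ) * (∫⁻ x, ∫⁻ y, sobKernel s p u x y)
    + ENNReal.ofReal ((2 ^ P * (2 / V) / ε₀ ^ N) ^ θ) * ∫⁻ x, ENNReal.ofReal (|u x| ^ pb) with hM
  have hMtop : M ≠ ⊤ := by
    rw [hM]
    exact ENNReal.add_ne_top.2 ⟨ENNReal.mul_ne_top ENNReal.ofReal_ne_top h2.ne,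
      ENNReal.mul_ne_top ENNReal.ofReal_ne_top h1.ne⟩
  have hDm : AEMeasurable (fun x => ∫⁻ y, sobKernel s p u x y) :=
    (sobKernel_aemeas s p hp u hu).lintegral_prod_right'
  have hk : ∀ k, ∫⁻ x, ENNReal.ofReal (v k x ^ P) ≤ ENNReal.ofReal (M.toReal ^ (1 - θ)⁻¹) := by
    intro k
    have hkfin : ∫⁻ x, ENNReal.ofReal (v k x ^ P) < ⊤ := by
      have : ∀ x, ENNReal.ofReal (v k x ^ P) ≤
          ENNReal.ofReal ((k:ℝ) ^ (P - pb)) * ENNReal.ofReal (|u x| ^ pb) := fun x => by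
        rw [← ENNReal.ofReal_mul (by positivity)]
        apply ENNReal.ofReal_le_ofReal
        rcases (hv0 k x).eq_or_lt with h0 | h0
        · rw [← h0, Real.zero_rpow hPpos.ne']; positivity
        · calc v k x ^ P = v k x ^ (P - pb) * v k x ^ pb := by
                rw [← Real.rpow_add h0]; congr 1; ring
            _ ≤ (k:ℝ) ^ (P - pb) * |u x| ^ pb := by
                have := hvu k x
                have : v k x ≤ k := min_le_right _ _
                have : 0 ≤ P - pb := by linarith
                gcongr
      refine (lintegral_mono this).trans_lt ?_
      rw [lintegral_const_mul' _ _ ENNReal.ofReal_ne_top]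
      exact ENNReal.mul_lt_top ENNReal.ofReal_lt_top h1
    set A := (∫⁻ x, ENNReal.ofReal (v k x ^ P)).toReal with hA
    have hAe : ∫⁻ x, ENNReal.ofReal (v k x ^ P) = ENNReal.ofReal A :=
      (ENNReal.ofReal_toReal hkfin.ne).symm
    rw [hAe]
    apply ENNReal.ofReal_le_ofReal
    rcases (show 0 ≤ A from ENNReal.toReal_nonneg).eq_or_lt with h0 | h0
    · rw [← h0]; positivity
    have hle : ENNReal.ofReal A ≤ ENNReal.ofReal (A ^ θ) * M := by
      rw [← hAe]
      refine (lintegral_mono fun x => sob_point hN s pb P θ ε₀ V hε hpb hs hPpos hθ hPθ hV0 hVv p hp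
        hdiag u (v k) hu (hvm k) (hvv k) (hv0 k) A h0 hAe.le x).trans ?_
      rw [lintegral_const_mul' _ _ ENNReal.ofReal_ne_top,
        lintegral_add_left' (hDm.const_mul _), lintegral_const_mul' _ _ ENNReal.ofReal_ne_top,
        lintegral_const_mul' _ _ ENNReal.ofReal_ne_top, hM]
      gcongr with x
      exact hvu k x
    have hAθ : 0 < A ^ θ := Real.rpow_pos_of_pos h0 _
    rw [← ENNReal.ofReal_toReal hMtop, ← ENNReal.ofReal_mul hAθ.le,
      ENNReal.ofReal_le_ofReal_iff (by positivity)] at hle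
    have h3 : A ^ (1 - θ) ≤ M.toReal := by
      rw [Real.rpow_sub h0, Real.rpow_one, div_le_iff₀ hAθ, mul_comm]; exact hle
    have h4 : 0 < 1 - θ := by linarith
    calc A = (A ^ (1 - θ)) ^ (1 - θ)⁻¹ := by
          rw [← Real.rpow_mul h0.le, mul_inv_cancel₀ h4.ne', Real.rpow_one]
      _ ≤ _ := by gcongr
  have hlim : ∀ x, liminf (fun k => ENNReal.ofReal (v k x ^ P)) atTop
      = ENNReal.ofReal (|u x| ^ P) := fun x => by
    apply Tendsto.liminf_eq
    apply tendsto_const_nhds.congr'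
    filter_upwards [tendsto_natCast_atTop_atTop.eventually_ge_atTop |u x|] with k hk
    simp only [hvdef]
    rw [min_eq_left hk]
  calc ∫⁻ x, ENNReal.ofReal (|u x| ^ P)
      = ∫⁻ x, liminf (fun k => ENNReal.ofReal (v k x ^ P)) atTop := by simp only [hlim]
    _ ≤ liminf (fun k => ∫⁻ x, ENNReal.ofReal (v k x ^ P)) atTop :=
        lintegral_liminf_le' fun k => ((hvm k).pow_const P).ennreal_ofReal
    _ ≤ liminf (fun _ : ℕ => ENNReal.ofReal (M.toReal ^ (1 - θ)⁻¹)) atTop :=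
        liminf_le_liminf (Eventually.of_forall hk)
    _ < ⊤ := by simp

/-- Theorem 4.3, first part: accounting of total masses, including
the possible loss of mass at infinity. -/
theorem ccp_at_infinity_masses {N : ℕ}
    (s pminus pbar ε₀ : ℝ) (hs : s ∈ Set.Ioo (0 : ℝ) 1)
    (p : Euc N → Euc N → ℝ) (pstar : Euc N → ℝ)
    (hpuc : UniformContinuous fun z : Euc N × Euc N => p z.1 z.2)
    (hpsym : ∀ x y, p x y = p y x)
    (hpminus : IsGLB (Set.range fun z : Euc N × Euc N => p z.1 z.2) pminus)
    (hpbar : IsLUB (Set.range fun z : Euc N × Euc N => p z.1 z.2) pbar)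
    (hpm1 : 1 < pminus) (hpbarN : pbar < (N : ℝ) / s)
    (hε₀ : ε₀ ∈ Set.Ioo (0 : ℝ) (1 / 2))
    (hdiag : ∀ x y : Euc N, dist x y < ε₀ → p x y = pbar)
    (hsupx : ∀ x : Euc N, IsLUB (Set.range (p x)) pbar)
    (hpstar : ∀ x : Euc N, IsGLB (Set.range (p x)) (pstar x))
    (hfin : volume {x : Euc N | pstar x ≠ pbar} < ⊤)
    (q : Euc N → ℝ) (hquc : UniformContinuous q)
    (pbarS : ℝ) (hpbarS : pbarS = (N : ℝ) * pbar / ((N : ℝ) - s * pbar))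
    (hqlb : ∀ x, pstar x ≤ q x) (hqub : ∀ x, q x ≤ pbarS)
    (hqcrit : {x : Euc N | q x = pbarS}.Nonempty)
    (un : ℕ → Euc N → ℝ) (u : Euc N → ℝ)
    (hmem : ∀ n, MemSob Set.univ s p (un n)) (humem : MemSob Set.univ s p u)
    (hbdd : ∃ C : ℝ, ∀ n, sobNorm Set.univ s p (un n) ≤ C)
    (hweak : WeakConvSob s p un u)
    (μ ν : Measure (Euc N)) (hμfin : IsFiniteMeasure μ) (hνfin : IsFiniteMeasure ν)
    (hμ : WeakStarConv (fun n => Ufun s p pbar (un n)) μ)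
    (hν : WeakStarConv (fun n x => |un n x| ^ q x) ν) :
    ∃ νinf μinf : ℝ,
      Tendsto (fun R : ℝ => limsup
          (fun n => ∫ x in {x : Euc N | R < ‖x‖}, |un n x| ^ q x) atTop)
        atTop (𝓝 νinf) ∧
      Tendsto (fun R : ℝ => limsup
          (fun n => ∫ x in {x : Euc N | R < ‖x‖}, Ufun s p pbar (un n) x) atTop)
        atTop (𝓝 μinf) ∧
      limsup (fun n => ∫ x, |un n x| ^ q x) atTop = (ν Set.univ).toReal + νinf ∧
      limsup (fun n => ∫ x, Ufun s p pbar (un n) x) atTop = (μ Set.univ).toReal + μinf := by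
  have hs0 : 0 < s := hs.1
  have hpb1 : 1 < pbar := by
    have h1 : pminus ≤ p 0 0 := hpminus.1 ⟨(0, 0), rfl⟩
    have h2 : p 0 0 ≤ pbar := hpbar.1 ⟨(0, 0), rfl⟩
    linarith
  have hpb0 : 0 < pbar := by linarith
  have hN : 0 < N := by
    rcases Nat.eq_zero_or_pos N with h | h
    · subst h
      simp at hpbarN
      linarith
    · exact h
  have hsp : s * pbar < N := by
    rw [lt_div_iff₀ hs0] at hpbarN
    linarith
  have hpc := hpuc.continuous
  have hum : ∀ n, AEMeasurable (un n) := fun n => by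
    have := (hmem n).1.aemeasurable
    rwa [Measure.restrict_univ] at this
  have hxx : ∀ x, p x x = pbar := fun x => hdiag x x (by simpa using hε₀.1)
  have hmod : ∀ n, (∫⁻ x, ENNReal.ofReal (|un n x| ^ pbar) < ⊤) ∧
      (∫⁻ x, ∫⁻ y, sobKernel s p (un n) x y < ⊤) := fun n => by
    have := (hmem n).2
    unfold sobModular at this
    simp only [Measure.restrict_univ, hxx] at this
    exact ENNReal.add_lt_top.1 this
  have hcrit : ∀ n, ∫⁻ x, ENNReal.ofReal (|un n x| ^ pbarS) < ⊤ := fun n =>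
    sob_embed hN s pbar pbarS ε₀ hε₀.1 hpb0 hs0 hsp hpbarS p hpc hdiag (un n) (hum n)
      (hmod n).1 (hmod n).2
  have habs : ∀ n, AEMeasurable (fun x => |un n x|) := fun n =>
    continuous_abs.measurable.comp_aemeasurable (hum n)
  have hint : ∀ n (a : ℝ), ∫⁻ x, ENNReal.ofReal (|un n x| ^ a) < ⊤ →
      Integrable (fun x => |un n x| ^ a) := fun n a h => by
    refine ⟨((habs n).pow_const a).aestronglyMeasurable, ?_⟩
    rw [hasFiniteIntegral_iff_ofReal (ae_of_all _ fun x => by positivity)]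
    exact h
  have hUint : ∀ n, Integrable (Ufun s p pbar (un n)) := fun n => by
    unfold Ufun
    refine (hint n pbar (hmod n).1).add (integrable_toReal_of_lintegral_ne_top ?_ (hmod n).2.ne)
    exact (sobKernel_aemeas s p hpc (un n) (hum n)).lintegral_prod_right'
  have hUnn : ∀ n x, 0 ≤ Ufun s p pbar (un n) x := fun n x => by
    unfold Ufun
    positivity
  set S := toMeasurable volume {x : Euc N | pstar x ≠ pbar} with hS
  have hSm : MeasurableSet S := measurableSet_toMeasurable _ _
  have hSf : volume S ≠ ⊤ := by rw [hS, measure_toMeasurable]; exact hfin.ne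
  have hqpos : ∀ x, 0 < q x := fun x => by
    have : pminus ≤ pstar x := (hpstar x).2 (by
      rintro _ ⟨y, rfl⟩
      exact hpminus.1 ⟨(x, y), rfl⟩)
    linarith [hqlb x]
  have hqint : ∀ n, Integrable (fun x => |un n x| ^ q x) := fun n => by
    have hg : Integrable (fun x => |un n x| ^ pbar + |un n x| ^ pbarS + S.indicator (fun _ => (1:ℝ)) x) :=
      ((hint n pbar (hmod n).1).add (hint n pbarS (hcrit n))).add
        ((integrable_indicator_iff hSm).2 (integrableOn_const hSf))
    refine hg.mono' ((habs n).pow hquc.continuous.measurable.aemeasurable).aestronglyMeasurable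
      (ae_of_all _ fun x => ?_)
    have e0 : 0 ≤ |un n x| := abs_nonneg _
    have e1 : 0 ≤ |un n x| ^ pbar := by positivity
    have e2 : 0 ≤ |un n x| ^ pbarS := by positivity
    have e3 : 0 ≤ S.indicator (fun _ => (1:ℝ)) x := indicator_nonneg (fun _ _ => zero_le_one) x
    rw [Real.norm_of_nonneg (by positivity)]
    rcases le_total 1 |un n x| with h1 | h1
    · have := Real.rpow_le_rpow_of_exponent_le h1 (hqub x)
      linarith
    by_cases hx : pstar x = pbar
    · have hq : pbar ≤ q x := hx ▸ hqlb x
      have : |un n x| ^ q x ≤ |un n x| ^ pbar := by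
        rcases e0.eq_or_lt with h | h
        · rw [← h, Real.zero_rpow (hqpos x).ne', Real.zero_rpow hpb0.ne']
        · exact Real.rpow_le_rpow_of_exponent_ge h h1 hq
      linarith
    · have hxS : x ∈ S := subset_toMeasurable _ _ hx
      rw [indicator_of_mem hxS]
      have := Real.rpow_le_one e0 h1 (hqpos x).le
      linarith
  obtain ⟨νinf, hν1, hν2⟩ := mass_split _ ν hqint (fun n x => by positivity) hν
  obtain ⟨μinf, hμ1, hμ2⟩ := mass_split _ μ hUint hUnn hμ
  exact ⟨νinf, μinf, hν1, hμ1, hν2, hμ2⟩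
end
end

section
/- Assume (P₂) and (Q₂), and additionally (E_∞): lim_{|x|,|y|→∞} p(x,y) = p̄ and lim_{|x|→∞} q(x) = q_∞ for some q_∞ ∈ (1,∞). Let {u_n} be a bounded sequence in W^{s,p(·,·)}(ℝ^N) with u_n ⇀ u weakly in W^{s,p(·,·)}(ℝ^N), U_n(x) := |u_n(x)|^{p̄} + ∫_{ℝ^N} |u_n(x)−u_n(y)|^{p(x,y)}/|x−y|^{N+s·p(x,y)} dy converging weakly-* to a finite Radon measure μ, and |u_n|^{q(x)} converging weakly-* to a finite Radon measure ν. Define ν_∞ := lim_{R→∞} limsup_{n→∞} ∫_{|x|>R} |u_n|^{q(x)} dx and μ_∞ := lim_{R→∞} limsup_{n→∞} ∫_{|x|>R} U_n(x) dx. Then S_q · ν_∞^{1/q_∞} ≤ μ_∞^{1/p̄}. -/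
open MeasureTheory Filter Topology Set
open scoped ENNReal NNReal

noncomputable section

/-- The best constant `S_q` of the imbedding `W^{s,p(·,·)}(ℝ^N) ↪ L^{q(·)}(ℝ^N)`. -/
def Sq {N : ℕ} (s : ℝ) (p : Euc N → Euc N → ℝ) (q : Euc N → ℝ) : ℝ :=
  sInf {c : ℝ | ∃ u : Euc N → ℝ, MemSob Set.univ s p u ∧ ¬ u =ᵐ[volume] 0 ∧
    c = sobNorm Set.univ s p u / luxNorm volume q u}

def gKer {N : ℕ} (s a R : ℝ) (z : Euc N) : ℝ :=
  (min 1 (‖z‖ / R) / ‖z‖ ^ s) ^ a / ‖z‖ ^ N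

lemma gKer_nonneg {N : ℕ} (s a R : ℝ) (hR : 0 ≤ R) (z : Euc N) : 0 ≤ gKer s a R z := by
  unfold gKer
  have : 0 ≤ min 1 (‖z‖ / R) := le_min zero_le_one (by positivity)
  positivity

lemma gKer_meas {N : ℕ} (s a R : ℝ) : Measurable (gKer (N := N) s a R) := by
  unfold gKer
  fun_prop

lemma gKer_int {N : ℕ} (hN : 0 < N) (s a : ℝ) (hs : s ∈ Set.Ioo (0 : ℝ) 1) (ha : 0 < a) :
    Integrable (gKer (N := N) s a 1) volume := by
  have : Nonempty (Fin N) := ⟨⟨0, hN⟩⟩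
  have key := integrable_fun_norm_addHaar (E := Euc N) (F := ℝ) (volume : Measure (Euc N))
    (f := fun r : ℝ => (min 1 (r / 1) / r ^ s) ^ a / r ^ N)
  unfold gKer
  rw [key]
  have hfr : Module.finrank ℝ (Euc N) = N := by simp
  rw [hfr]
  rw [← Ioc_union_Ioi_eq_Ioi (zero_le_one' ℝ)]
  have hpow : ∀ r : ℝ, 0 < r → r ^ (N - 1) / r ^ N = r ^ (-1 : ℝ) := by
    intro r hr
    obtain ⟨k, rfl⟩ : ∃ k, N = k + 1 := ⟨N - 1, by omega⟩
    rw [Real.rpow_neg_one]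
    simp only [Nat.add_sub_cancel]
    field_simp
    ring
  refine IntegrableOn.union ?_ ?_
  · have h1 : IntegrableOn (fun r : ℝ => r ^ (-1 + (1 - s) * a)) (Ioc 0 1) := by
      have := intervalIntegral.intervalIntegrable_rpow' (a := 0) (b := 1) (r := -1 + (1 - s) * a)
        (by have := hs.2; nlinarith)
      rwa [intervalIntegrable_iff, uIoc_of_le zero_le_one] at this
    refine h1.congr_fun (fun r hr => ?_) measurableSet_Ioc
    have hr0 : 0 < r := hr.1
    simp only [div_one, smul_eq_mul]
    rw [min_eq_right hr.2]
    have e1 : r / r ^ s = r ^ (1 - s) := by rw [Real.rpow_sub hr0, Real.rpow_one]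
    rw [e1, ← Real.rpow_mul hr0.le, Real.rpow_add hr0, ← hpow r hr0]
    ring
  · have h1 : IntegrableOn (fun r : ℝ => r ^ (-1 + (- s) * a)) (Ioi 1) := by
      apply integrableOn_Ioi_rpow_of_lt _ one_pos
      have := hs.1; nlinarith
    refine h1.congr_fun (fun r hr => ?_) measurableSet_Ioi
    have hr1 : 1 < r := hr
    have hr0 : 0 < r := by linarith
    simp only [div_one, smul_eq_mul]
    rw [min_eq_left hr1.le]
    have e1 : 1 / r ^ s = r ^ (- s) := by rw [Real.rpow_neg hr0.le, one_div]
    rw [e1, ← Real.rpow_mul hr0.le, Real.rpow_add hr0, ← hpow r hr0]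
    ring

lemma gKer_tendsto {N : ℕ} (hN : 0 < N) (s a : ℝ) (hs : s ∈ Set.Ioo (0 : ℝ) 1) (ha : 0 < a) :
    Tendsto (fun R : ℝ => ∫⁻ z : Euc N, ENNReal.ofReal (gKer s a R z)) atTop (𝓝 0) := by
  have h := tendsto_lintegral_filter_of_dominated_convergence (l := (atTop : Filter ℝ))
    (μ := (volume : Measure (Euc N)))
    (F := fun R z => ENNReal.ofReal (gKer s a R z)) (f := fun _ => 0)
    (fun z => ENNReal.ofReal (gKer s a 1 z))
    (Eventually.of_forall fun R => (gKer_meas s a R).ennreal_ofReal) ?_ ?_ ?_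
  · simpa using h
  · filter_upwards [eventually_ge_atTop (1 : ℝ)] with R hR
    refine Eventually.of_forall fun z => ENNReal.ofReal_le_ofReal ?_
    unfold gKer
    have : 0 ≤ min 1 (‖z‖ / R) := le_min zero_le_one (by positivity)
    have h2 : min 1 (‖z‖ / R) ≤ min 1 (‖z‖ / 1) := by
      apply min_le_min le_rfl; gcongr
    gcongr
  · exact (gKer_int hN s a hs ha).lintegral_lt_top.ne
  · refine Eventually.of_forall fun z => ?_
    rw [← ENNReal.ofReal_zero]
    apply ENNReal.tendsto_ofReal
    unfold gKer
    have h1 : Tendsto (fun R : ℝ => ‖z‖ / R) atTop (𝓝 0) := tendsto_const_nhds.div_atTop tendsto_id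
    have h2 : Tendsto (fun R : ℝ => min 1 (‖z‖ / R)) atTop (𝓝 0) := by
      have := (tendsto_const_nhds (x := (1:ℝ))).min h1
      simpa using this
    have h3 := ((h2.div_const (‖z‖ ^ s)).rpow_const (p := a) (Or.inr ha.le)).div_const (‖z‖ ^ N)
    simpa [Real.zero_rpow ha.ne'] using h3

lemma conv_ineq {P pb t : ℝ} (hP : 1 ≤ P) (hPb : P ≤ pb) (ht0 : 0 < t) (ht1 : t < 1) (a b : ℝ) :
    |a + b| ^ P ≤ (1 - t) ^ (-pb) * |a| ^ P + t ^ (-pb) * |b| ^ P := by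
  have hu : 0 < 1 - t := by linarith
  have hc := (convexOn_rpow hP).2 (x := |a| / (1 - t)) (y := |b| / t)
    (by simp; positivity) (by simp; positivity) hu.le ht0.le (by ring)
  simp only [smul_eq_mul] at hc
  rw [mul_div_cancel₀ _ hu.ne', mul_div_cancel₀ _ ht0.ne',
    Real.div_rpow (abs_nonneg _) hu.le, Real.div_rpow (abs_nonneg _) ht0.le] at hc
  have hb : ∀ w : ℝ, 0 < w → w < 1 → ∀ c : ℝ, w * (|c| ^ P / w ^ P) ≤ w ^ (-pb) * |c| ^ P := by
    intro w hw hw1 c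
    have h1 : w ^ (-P) ≤ w ^ (-pb) := Real.rpow_le_rpow_of_exponent_ge hw hw1.le (by linarith)
    rw [Real.rpow_neg hw.le] at h1
    have h2 : 0 ≤ |c| ^ P := by positivity
    have h3 : 0 ≤ (w ^ P)⁻¹ := by positivity
    calc w * (|c| ^ P / w ^ P) = w * ((w ^ P)⁻¹ * |c| ^ P) := by ring
      _ ≤ 1 * ((w ^ P)⁻¹ * |c| ^ P) := by gcongr
      _ ≤ _ := by rw [one_mul]; gcongr
  calc |a + b| ^ P ≤ (|a| + |b|) ^ P := by
        gcongr; exact abs_add_le a b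
    _ ≤ _ := hc
    _ ≤ _ := add_le_add (hb _ hu (by linarith) a) (hb _ ht0 ht1 b)

def cut {N : ℕ} (R : ℝ) (x : Euc N) : ℝ := max 0 (min 1 (‖x‖ / R - 1))

lemma cut_nonneg {N : ℕ} (R : ℝ) (x : Euc N) : 0 ≤ cut R x := le_max_left _ _

lemma cut_le_one {N : ℕ} (R : ℝ) (x : Euc N) : cut R x ≤ 1 :=
  max_le zero_le_one (min_le_left _ _)

lemma cut_cont {N : ℕ} (R : ℝ) : Continuous (cut (N := N) R) := by
  unfold cut; fun_prop

lemma cut_zero {N : ℕ} {R : ℝ} (hR : 0 < R) {x : Euc N} (hx : ‖x‖ ≤ R) : cut R x = 0 := by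
  unfold cut
  apply max_eq_left
  apply min_le_of_right_le
  have : ‖x‖ / R ≤ 1 := by rwa [div_le_one hR]
  linarith

lemma cut_one {N : ℕ} {R : ℝ} (hR : 0 < R) {x : Euc N} (hx : 2 * R ≤ ‖x‖) : cut R x = 1 := by
  unfold cut
  have : 2 ≤ ‖x‖ / R := by rwa [le_div_iff₀ hR]
  rw [min_eq_left (by linarith)]
  simp

lemma cut_sub {N : ℕ} {R : ℝ} (hR : 0 < R) (x y : Euc N) :
    |cut R x - cut R y| ≤ min 1 (dist x y / R) := by
  refine le_min ?_ ?_
  · have := cut_nonneg R x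
    have := cut_nonneg R y
    have := cut_le_one R x
    have := cut_le_one R y
    rw [abs_le]; constructor <;> linarith
  · have h1 : |cut R x - cut R y| ≤ |(‖x‖ / R - 1) - (‖y‖ / R - 1)| := by
      unfold cut
      refine (abs_max_sub_max_le_max _ _ _ _).trans ?_
      simp only [sub_self, abs_zero]
      refine max_le (abs_nonneg _) ?_
      refine (abs_min_sub_min_le_max _ _ _ _).trans ?_
      simp
    refine h1.trans ?_
    have h2 : (‖x‖ / R - 1) - (‖y‖ / R - 1) = (‖x‖ - ‖y‖) / R := by ring
    rw [h2, abs_div, abs_of_pos hR]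
    gcongr
    rw [dist_eq_norm]
    exact abs_norm_sub_norm_le x y

lemma ker_real {N : ℕ} {s a R l t P pb L κ i d fx fy ux uy Gx Gy : ℝ}
    (hs : s ∈ Set.Ioo (0 : ℝ) 1) (ha : 1 ≤ a) (haP : a ≤ P) (hP : P ≤ pb) (hR : 1 ≤ R) (hl : 0 < l)
    (ht0 : 0 < t) (ht1 : t < 1) (hL : l ^ P ≤ L) (hκ : 0 ≤ κ) (hi : 0 ≤ i) (hd : 0 < d)
    (hfx0 : 0 ≤ fx) (hfx1 : fx ≤ 1) (hf : |fx - fy| ≤ min 1 (d / R))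
    (hGx : |ux| ^ P ≤ Gx) (hGy : |uy| ^ P ≤ Gy)
    (hcase : fx = 0 ∨ (i = 1 ∧ l ^ P ≤ κ) ∨ R / 2 ≤ d) :
    |fx * ux * l - fy * uy * l| ^ P / d ^ ((N : ℝ) + s * P) ≤
      (1 - t) ^ (-pb) * κ * i * (|ux - uy| ^ P / d ^ ((N : ℝ) + s * P)) +
      ((1 - t) ^ (-pb) * L * (2 ^ pb * 2 ^ pb) + t ^ (-pb) * L) * (Gx + Gy) *
        ((min 1 (d / R) / d ^ s) ^ a / d ^ N) := by
  have hP1 : 1 ≤ P := ha.trans haP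
  have hP0 : 0 < P := by linarith
  have hR0 : 0 < R := by linarith
  have h1t : 0 < 1 - t := by linarith
  have hE : d ^ ((N : ℝ) + s * P) = (d ^ s) ^ P * d ^ N := by
    rw [Real.rpow_add hd, Real.rpow_natCast, Real.rpow_mul hd.le]; ring
  rw [hE]
  set A := (1 - t) ^ (-pb) with hA
  set B := t ^ (-pb) with hB
  have hA0 : 0 ≤ A := by positivity
  have hB0 : 0 ≤ B := by positivity
  set m := min 1 (d / R) with hm
  have hm0 : 0 < m := lt_min one_pos (by positivity)
  have hds : 0 < d ^ s := by positivity
  have hw1 : m / d ^ s ≤ 1 := by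
    rw [div_le_one hds]
    rcases le_total 1 d with h | h
    · exact (min_le_left _ _).trans (Real.one_le_rpow h hs.1.le)
    · have h2 : d ≤ d ^ s := by
        conv_lhs => rw [← Real.rpow_one d]
        exact Real.rpow_le_rpow_of_exponent_ge hd h hs.2.le
      exact ((min_le_right _ _).trans (div_le_self hd.le hR)).trans h2
  have hw0 : 0 < m / d ^ s := by positivity
  set gK := (m / d ^ s) ^ a / d ^ N with hgK
  have hgK0 : 0 ≤ gK := by positivity
  set E := (d ^ s) ^ P * d ^ N with hEdef
  have hE0 : 0 < E := by positivity
  have hmE : m ^ P / E ≤ gK := by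
    have : m ^ P / E = (m / d ^ s) ^ P / d ^ N := by
      rw [Real.div_rpow hm0.le hds.le, hEdef, div_div]
    rw [this, hgK]
    gcongr ?_ / _
    exact Real.rpow_le_rpow_of_exponent_ge hw0 hw1 haP
  have hL0 : 0 ≤ L := le_trans (by positivity) hL
  have hGx0 : 0 ≤ Gx := le_trans (by positivity) hGx
  have hGy0 : 0 ≤ Gy := le_trans (by positivity) hGy
  have hsplit : fx * ux * l - fy * uy * l = fx * (ux - uy) * l + uy * (fx - fy) * l := by ring
  have h1 := conv_ineq hP1 hP ht0 ht1 (fx * (ux - uy) * l) (uy * (fx - fy) * l)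
  rw [← hsplit, ← hA, ← hB] at h1
  have ea : |fx * (ux - uy) * l| ^ P = fx ^ P * |ux - uy| ^ P * l ^ P := by
    rw [abs_mul, abs_mul, abs_of_nonneg hfx0, abs_of_pos hl, Real.mul_rpow (by positivity) hl.le,
      Real.mul_rpow hfx0 (abs_nonneg _)]
  have eb : |uy * (fx - fy) * l| ^ P = |uy| ^ P * |fx - fy| ^ P * l ^ P := by
    rw [abs_mul, abs_mul, abs_of_pos hl, Real.mul_rpow (by positivity) hl.le,
      Real.mul_rpow (abs_nonneg _) (abs_nonneg _)]
  rw [ea, eb] at h1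
  have hb : B * (|uy| ^ P * |fx - fy| ^ P * l ^ P) / E ≤ B * L * Gy * gK := by
    have : |fx - fy| ^ P ≤ m ^ P := by gcongr
    calc B * (|uy| ^ P * |fx - fy| ^ P * l ^ P) / E ≤ B * (Gy * m ^ P * L) / E := by gcongr
      _ = B * L * Gy * (m ^ P / E) := by ring
      _ ≤ _ := by gcongr
  have hfxP : fx ^ P ≤ 1 := Real.rpow_le_one hfx0 hfx1 hP0.le
  have haa : A * (fx ^ P * |ux - uy| ^ P * l ^ P) / E ≤
      A * κ * i * (|ux - uy| ^ P / E) + A * L * (2 ^ pb * 2 ^ pb) * (Gx + Gy) * gK := by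
    have n1 : 0 ≤ A * κ * i * (|ux - uy| ^ P / E) := by positivity
    have n2 : 0 ≤ A * L * (2 ^ pb * 2 ^ pb) * (Gx + Gy) * gK := by positivity
    rcases hcase with h | ⟨h, h'⟩ | h
    · rw [h, Real.zero_rpow hP0.ne']
      simp only [zero_mul, mul_zero, zero_div]
      linarith
    · have : A * (fx ^ P * |ux - uy| ^ P * l ^ P) / E ≤ A * κ * i * (|ux - uy| ^ P / E) := by
        calc A * (fx ^ P * |ux - uy| ^ P * l ^ P) / E ≤ A * (1 * |ux - uy| ^ P * κ) / E := by
              gcongr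
          _ = _ := by rw [h]; ring
      linarith
    · have h2m : 1 ≤ 2 * m := by
        have : 1 / 2 ≤ m := by
          refine le_min (by norm_num) ?_
          rw [le_div_iff₀ hR0]; linarith
        linarith
      have h2P : (2:ℝ) ^ P ≤ 2 ^ pb := Real.rpow_le_rpow_of_exponent_le (by norm_num) hP
      have hE1 : 1 / E ≤ 2 ^ pb * gK := by
        have h3 : 1 ≤ 2 ^ pb * m ^ P := by
          calc (1:ℝ) ≤ (2 * m) ^ P := Real.one_le_rpow h2m hP0.le
            _ = 2 ^ P * m ^ P := Real.mul_rpow (by norm_num) hm0.le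
            _ ≤ _ := by gcongr
        calc 1 / E ≤ (2 ^ pb * m ^ P) / E := by gcongr
          _ = 2 ^ pb * (m ^ P / E) := by ring
          _ ≤ _ := by gcongr
      have hd2 : |ux - uy| ^ P ≤ 2 ^ pb * (Gx + Gy) := by
        have h4 : |ux - uy| ≤ 2 * max |ux| |uy| := by
          have := abs_sub ux uy
          have := le_max_left |ux| |uy|
          have := le_max_right |ux| |uy|
          linarith
        have h5 : (max |ux| |uy|) ^ P ≤ Gx + Gy := by
          rcases max_choice |ux| |uy| with h | h <;> rw [h] <;> linarith
        calc |ux - uy| ^ P ≤ (2 * max |ux| |uy|) ^ P := by gcongr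
          _ = 2 ^ P * (max |ux| |uy|) ^ P := Real.mul_rpow (by norm_num) (by positivity)
          _ ≤ _ := by gcongr
      have : A * (fx ^ P * |ux - uy| ^ P * l ^ P) / E ≤
          A * L * (2 ^ pb * 2 ^ pb) * (Gx + Gy) * gK := by
        calc A * (fx ^ P * |ux - uy| ^ P * l ^ P) / E
            ≤ A * (1 * (2 ^ pb * (Gx + Gy)) * L) / E := by gcongr
          _ = A * L * (2 ^ pb * (Gx + Gy)) * (1 / E) := by ring
          _ ≤ A * L * (2 ^ pb * (Gx + Gy)) * (2 ^ pb * gK) := by gcongr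
          _ = _ := by ring
      linarith
  have hn : 0 ≤ B * L * Gx * gK := by positivity
  calc |fx * ux * l - fy * uy * l| ^ P / E
      ≤ (A * (fx ^ P * |ux - uy| ^ P * l ^ P) + B * (|uy| ^ P * |fx - fy| ^ P * l ^ P)) / E := by
        gcongr
    _ = A * (fx ^ P * |ux - uy| ^ P * l ^ P) / E
        + B * (|uy| ^ P * |fx - fy| ^ P * l ^ P) / E := by rw [add_div]
    _ ≤ (A * κ * i * (|ux - uy| ^ P / E) + A * L * (2 ^ pb * 2 ^ pb) * (Gx + Gy) * gK)
        + B * L * Gy * gK := add_le_add haa hb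
    _ ≤ _ := by linarith

lemma sobKernel_aem {N : ℕ} (s : ℝ) {p : Euc N → Euc N → ℝ}
    (hp : Continuous fun z : Euc N × Euc N => p z.1 z.2) {u : Euc N → ℝ}
    (hu : AEMeasurable u volume) :
    AEMeasurable (fun z : Euc N × Euc N => sobKernel s p u z.1 z.2)
      ((volume : Measure (Euc N)).prod volume) := by
  unfold sobKernel
  have h1 : AEMeasurable (fun z : Euc N × Euc N => u z.1) (volume.prod volume) := hu.comp_fst
  have h2 : AEMeasurable (fun z : Euc N × Euc N => u z.2) (volume.prod volume) := hu.comp_snd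
  have hpm : Measurable fun z : Euc N × Euc N => p z.1 z.2 := hp.measurable
  have h3 : AEMeasurable (fun z : Euc N × Euc N => |u z.1 - u z.2|) (volume.prod volume) :=
    continuous_abs.measurable.comp_aemeasurable (h1.sub h2)
  have h4 : Measurable (fun z : Euc N × Euc N => dist z.1 z.2) := continuous_dist.measurable
  exact ((h3.pow hpm.aemeasurable).div
    (h4.pow (measurable_const.add (measurable_const.mul hpm))).aemeasurable).ennreal_ofReal

lemma mod_cut {N : ℕ} {s pm pb R l t L κ : ℝ} {p : Euc N → Euc N → ℝ}
    (hs : s ∈ Set.Ioo (0 : ℝ) 1) (hpm : 1 < pm) (hpl : ∀ x y, pm ≤ p x y) (hpu : ∀ x y, p x y ≤ pb)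
    (hpsym : ∀ x y, p x y = p y x) (hpd : ∀ x, p x x = pb)
    {A : Set (Euc N)} (hA : MeasurableSet A) (hAp : ∀ x y, x ∉ A → p x y = pb)
    (hR : 1 ≤ R) (hl : 0 < l) (ht0 : 0 < t) (ht1 : t < 1) (hL : ∀ x y, l ^ p x y ≤ L)
    (hκl : l ^ pb ≤ κ)
    (hκ : ∀ x y : Euc N, R / 2 < ‖x‖ → R / 2 < ‖y‖ → l ^ p x y ≤ κ)
    {u : Euc N → ℝ} (hu : AEMeasurable u volume) :
    sobModular Set.univ s p (fun x => cut R x * u x * l) ≤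
      ENNReal.ofReal ((1 - t) ^ (-pb) * κ) * (∫⁻ x in {x : Euc N | R < ‖x‖},
        (ENNReal.ofReal (|u x| ^ pb) + ∫⁻ y, sobKernel s p u x y)) +
      ENNReal.ofReal ((1 - t) ^ (-pb) * L * (2 ^ pb * 2 ^ pb) + t ^ (-pb) * L) *
        (2 * ((∫⁻ x, ENNReal.ofReal (|u x| ^ pb)) + volume A) *
          ∫⁻ z : Euc N, ENNReal.ofReal (gKer s pm R z)) := by
  have hR0 : 0 < R := by linarith
  have h1t : 0 < 1 - t := by linarith
  have hpb : 1 < pb := by have := hpl 0 0; have := hpu 0 0; linarith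
  have hκ0 : 0 ≤ κ := le_trans (by positivity) hκl
  have hL0 : 0 ≤ L := le_trans (by positivity) (hL 0 0)
  set c0 := (1 - t) ^ (-pb) * κ with hc0
  set D := (1 - t) ^ (-pb) * L * (2 ^ pb * 2 ^ pb) + t ^ (-pb) * L with hD
  have hc00 : 0 ≤ c0 := by positivity
  have hD0 : 0 ≤ D := by positivity
  set T : Set (Euc N) := {x | R < ‖x‖} with hT
  have hTm : MeasurableSet T := measurableSet_lt measurable_const measurable_norm
  set G : Euc N → ℝ := fun x => |u x| ^ pb + A.indicator 1 x with hG
  have hind0 : ∀ x, 0 ≤ A.indicator (1 : Euc N → ℝ) x := fun x =>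
    Set.indicator_nonneg (fun _ _ => zero_le_one) x
  have hG0 : ∀ x, 0 ≤ G x := fun x => add_nonneg (by positivity) (hind0 x)
  have hGp : ∀ x y, |u x| ^ p x y ≤ G x := by
    intro x y
    by_cases hx : x ∈ A
    · simp only [hG, Set.indicator_of_mem hx, Pi.one_apply]
      have hp0 : 0 ≤ p x y := by have := hpl x y; linarith
      rcases le_total (|u x|) 1 with h | h
      · have h1 := Real.rpow_le_one (abs_nonneg (u x)) h hp0
        have h2 : 0 ≤ |u x| ^ pb := by positivity
        linarith
      · have h1 := Real.rpow_le_rpow_of_exponent_le h (hpu x y)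
        linarith
    · rw [hAp x y hx]
      have := hind0 x
      simp only [hG]; linarith
  have hcm : ∀ x : Euc N, 0 ≤ cut R x := cut_nonneg R
  have hpt : ∀ x y, sobKernel s p (fun x => cut R x * u x * l) x y ≤
      ENNReal.ofReal c0 * (T.indicator 1 x * sobKernel s p u x y) +
      ENNReal.ofReal D * ((ENNReal.ofReal (G x) + ENNReal.ofReal (G y)) *
        ENNReal.ofReal (gKer s pm R (x - y))) := by
    intro x y
    rcases eq_or_ne x y with rfl | hxy
    · have : sobKernel s p (fun x => cut R x * u x * l) x x = 0 := by
        have : p x x ≠ 0 := by rw [hpd]; linarith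
        simp [sobKernel, Real.zero_rpow this]
      rw [this]; exact zero_le
    have hd : 0 < dist x y := dist_pos.2 hxy
    have hcase : cut R x = 0 ∨ (T.indicator (1 : Euc N → ℝ) x = 1 ∧ l ^ p x y ≤ κ) ∨
        R / 2 ≤ dist x y := by
      rcases le_or_gt ‖x‖ R with h | h
      · exact Or.inl (cut_zero hR0 h)
      · right
        rcases le_or_gt ‖y‖ (R / 2) with h' | h'
        · right
          rw [dist_eq_norm]
          have := norm_sub_norm_le x y
          linarith
        · left
          have hxT : x ∈ T := h
          exact ⟨by simp [hxT], hκ x y (by linarith) h'⟩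
    have hGy : |u y| ^ p x y ≤ G y := by rw [hpsym x y]; exact hGp y x
    have hi0 : 0 ≤ T.indicator (1 : Euc N → ℝ) x :=
      Set.indicator_nonneg (fun _ _ => zero_le_one) x
    have hk := ker_real (N := N) hs hpm.le (hpl x y) (hpu x y) hR hl ht0 ht1 (hL x y) hκ0 hi0 hd
      (cut_nonneg R x) (cut_le_one R x) (cut_sub hR0 x y) (hGp x y) hGy hcase
    have hgk : gKer s pm R (x - y) =
      (min 1 (dist x y / R) / dist x y ^ s) ^ pm / dist x y ^ N := by
      rw [dist_eq_norm]; rfl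
    rw [← hc0, ← hD, ← hgk] at hk
    have hk' := ENNReal.ofReal_le_ofReal hk
    have hind : ENNReal.ofReal (T.indicator (1 : Euc N → ℝ) x) =
        T.indicator (1 : Euc N → ℝ≥0∞) x := by
      by_cases h : x ∈ T <;> simp [h]
    unfold sobKernel
    refine hk'.trans (le_of_eq ?_)
    have q1 : 0 ≤ |u x - u y| ^ p x y / dist x y ^ ((N : ℝ) + s * p x y) := by positivity
    have q2 := gKer_nonneg s pm R hR0.le (x - y)
    have q3 := hG0 x
    have q4 := hG0 y
    clear_value c0 D
    rw [ENNReal.ofReal_add (by positivity) (by positivity), ENNReal.ofReal_mul (by positivity),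
      ENNReal.ofReal_mul hc00, ENNReal.ofReal_mul (by positivity), ENNReal.ofReal_mul hD0,
      ENNReal.ofReal_add q3 q4, hind, mul_assoc, mul_assoc]
  -- measurability
  have hGm : AEMeasurable (fun x => ENNReal.ofReal (G x)) volume :=
    (((continuous_abs.measurable.comp_aemeasurable hu).pow_const pb).add
      ((measurable_one.indicator hA).aemeasurable)).ennreal_ofReal
  have hgm : Measurable (fun z : Euc N => ENNReal.ofReal (gKer s pm R z)) :=
    (gKer_meas s pm R).ennreal_ofReal
  have hgm2 : Measurable (fun z : Euc N × Euc N => ENNReal.ofReal (gKer s pm R (z.1 - z.2))) :=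
    hgm.comp (measurable_fst.sub measurable_snd)
  set kR := ∫⁻ z : Euc N, ENNReal.ofReal (gKer s pm R z) with hkR
  set IG := ∫⁻ x, ENNReal.ofReal (G x) with hIG
  have hIGe : IG = (∫⁻ x, ENNReal.ofReal (|u x| ^ pb)) + volume A := by
    rw [hIG]
    have : ∀ x, ENNReal.ofReal (G x) = ENNReal.ofReal (|u x| ^ pb) +
        A.indicator (1 : Euc N → ℝ≥0∞) x := by
      intro x
      simp only [hG]
      rw [ENNReal.ofReal_add (by positivity) (hind0 x)]
      congr 1
      by_cases h : x ∈ A <;> simp [h]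
    simp_rw [this]
    rw [lintegral_add_right _ (measurable_one.indicator hA), lintegral_indicator_one hA]
  have hjm : AEMeasurable (fun z : Euc N × Euc N =>
      (ENNReal.ofReal (G z.1) + ENNReal.ofReal (G z.2)) *
        ENNReal.ofReal (gKer s pm R (z.1 - z.2))) (volume.prod volume) :=
    (hGm.comp_fst.add hGm.comp_snd).mul hgm2.aemeasurable
  have hI2 : ∫⁻ x, ∫⁻ y, (ENNReal.ofReal (G x) + ENNReal.ofReal (G y)) *
      ENNReal.ofReal (gKer s pm R (x - y)) = 2 * IG * kR := by
    have e1 : ∀ x, ∫⁻ y, (ENNReal.ofReal (G x) + ENNReal.ofReal (G y)) *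
      ENNReal.ofReal (gKer s pm R (x - y)) = ENNReal.ofReal (G x) * kR +
        ∫⁻ y, ENNReal.ofReal (G y) * ENNReal.ofReal (gKer s pm R (x - y)) := by
      intro x
      have hmx : Measurable fun y => ENNReal.ofReal (gKer s pm R (x - y)) :=
        hgm.comp (measurable_const.sub measurable_id)
      simp_rw [add_mul]
      rw [lintegral_add_left (hmx.const_mul _), lintegral_const_mul _ hmx,
        lintegral_sub_left_eq_self (fun z => ENNReal.ofReal (gKer s pm R z)) x]
    simp_rw [e1]
    rw [lintegral_add_left' (hGm.mul_const _), lintegral_mul_const'' _ hGm,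
      lintegral_lintegral_swap (hGm.comp_snd.mul hgm2.aemeasurable)]
    have e2 : ∀ y, ∫⁻ x, ENNReal.ofReal (G y) * ENNReal.ofReal (gKer s pm R (x - y)) =
        ENNReal.ofReal (G y) * kR := by
      intro y
      have hmx : Measurable fun x => ENNReal.ofReal (gKer s pm R (x - y)) :=
        hgm.comp (measurable_id.sub measurable_const)
      rw [lintegral_const_mul _ hmx,
        lintegral_sub_right_eq_self (fun z => ENNReal.ofReal (gKer s pm R z)) y]
    simp_rw [e2]
    rw [lintegral_mul_const'' _ hGm]
    ring
  have hI2m : AEMeasurable (fun x => ∫⁻ y, (ENNReal.ofReal (G x) + ENNReal.ofReal (G y)) *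
      ENNReal.ofReal (gKer s pm R (x - y))) volume := hjm.lintegral_prod_right'
  have hker : ∫⁻ x, ∫⁻ y, sobKernel s p (fun x => cut R x * u x * l) x y ≤
      ENNReal.ofReal c0 * (∫⁻ x, T.indicator 1 x * ∫⁻ y, sobKernel s p u x y) +
        ENNReal.ofReal D * (2 * IG * kR) := by
    calc ∫⁻ x, ∫⁻ y, sobKernel s p (fun x => cut R x * u x * l) x y
        ≤ ∫⁻ x, (ENNReal.ofReal c0 * (T.indicator 1 x * ∫⁻ y, sobKernel s p u x y) +
          ENNReal.ofReal D * ∫⁻ y, (ENNReal.ofReal (G x) + ENNReal.ofReal (G y)) *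
            ENNReal.ofReal (gKer s pm R (x - y))) := by
          refine lintegral_mono fun x => ?_
          have hmx : AEMeasurable (fun y => (ENNReal.ofReal (G x) + ENNReal.ofReal (G y)) *
              ENNReal.ofReal (gKer s pm R (x - y))) volume :=
            (aemeasurable_const.add hGm).mul
              (hgm.comp (measurable_const.sub measurable_id)).aemeasurable
          refine (lintegral_mono (hpt x)).trans ?_
          rw [lintegral_add_right' _ (hmx.const_mul _), lintegral_const_mul'' _ hmx,
            lintegral_const_mul' _ _ ENNReal.ofReal_ne_top, lintegral_const_mul']
          by_cases h : x ∈ T <;> simp [h]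
      _ = _ := by
          rw [lintegral_add_right' _ (hI2m.const_mul _), lintegral_const_mul'' _ hI2m,
            lintegral_const_mul' _ _ ENNReal.ofReal_ne_top, hI2]
  have hfirst : ∫⁻ x, ENNReal.ofReal (|cut R x * u x * l| ^ p x x) ≤
      ENNReal.ofReal c0 * ∫⁻ x, T.indicator 1 x * ENNReal.ofReal (|u x| ^ pb) := by
    rw [← lintegral_const_mul' _ _ ENNReal.ofReal_ne_top]
    refine lintegral_mono fun x => ?_
    simp only [hpd]
    by_cases h : x ∈ T
    · rw [Set.indicator_of_mem h, Pi.one_apply, one_mul, ← ENNReal.ofReal_mul hc00]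
      apply ENNReal.ofReal_le_ofReal
      rw [abs_mul, abs_mul, abs_of_pos hl, abs_of_nonneg (cut_nonneg R x),
        Real.mul_rpow (by have := hcm x; positivity) hl.le,
        Real.mul_rpow (cut_nonneg R x) (abs_nonneg _)]
      have k1 : cut R x ^ pb ≤ 1 :=
        Real.rpow_le_one (cut_nonneg R x) (cut_le_one R x) (by linarith)
      have k2 : 1 ≤ (1 - t) ^ (-pb) :=
        Real.one_le_rpow_of_pos_of_le_one_of_nonpos h1t (by linarith) (by linarith)
      have k3 : 0 ≤ |u x| ^ pb := by positivity
      calc cut R x ^ pb * |u x| ^ pb * l ^ pb ≤ 1 * |u x| ^ pb * κ := by gcongr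
        _ = 1 * κ * |u x| ^ pb := by ring
        _ ≤ _ := by rw [hc0]; gcongr
    · have hx : cut R x = 0 := cut_zero hR0 (not_lt.1 h)
      rw [hx]
      have : pb ≠ 0 := by linarith
      simp [Real.zero_rpow this]
  unfold sobModular
  simp only [Measure.restrict_univ]
  refine (add_le_add hfirst hker).trans (le_of_eq ?_)
  rw [← add_assoc, ← mul_add, hIGe]
  congr 2
  have hum : AEMeasurable (fun x => T.indicator 1 x * ENNReal.ofReal (|u x| ^ pb)) volume :=
    ((measurable_one.indicator hTm).aemeasurable).mul
      ((continuous_abs.measurable.comp_aemeasurable hu).pow_const pb).ennreal_ofReal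
  rw [← lintegral_add_left' hum, ← lintegral_indicator hTm]
  refine lintegral_congr fun x => ?_
  by_cases h : x ∈ T <;> simp [h]

lemma sobModular_scale {N : ℕ} {s a L : ℝ} {p : Euc N → Euc N → ℝ} (ha : 0 ≤ a)
    (hL : ∀ x y, a ^ p x y ≤ L) (u : Euc N → ℝ) :
    sobModular Set.univ s p (fun x => a * u x) ≤
      ENNReal.ofReal L * sobModular Set.univ s p u := by
  have hL0 : 0 ≤ L := le_trans (by positivity) (hL 0 0)
  unfold sobModular
  simp only [Measure.restrict_univ]
  rw [mul_add, ← lintegral_const_mul' _ _ ENNReal.ofReal_ne_top,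
    ← lintegral_const_mul' _ _ ENNReal.ofReal_ne_top]
  refine add_le_add (lintegral_mono fun x => ?_) (lintegral_mono fun x => ?_)
  · rw [← ENNReal.ofReal_mul hL0]
    apply ENNReal.ofReal_le_ofReal
    rw [abs_mul, abs_of_nonneg ha, Real.mul_rpow ha (abs_nonneg _)]
    have := hL x x
    gcongr
  · dsimp only
    rw [← lintegral_const_mul' _ _ ENNReal.ofReal_ne_top]
    refine lintegral_mono fun y => ?_
    unfold sobKernel
    rw [← ENNReal.ofReal_mul hL0]
    apply ENNReal.ofReal_le_ofReal
    rw [← mul_sub, abs_mul, abs_of_nonneg ha, Real.mul_rpow ha (abs_nonneg _), mul_div_assoc]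
    have := hL x y
    gcongr

lemma rpow_le_max {a P pb : ℝ} (ha : 0 ≤ a) (hP0 : 0 ≤ P) (hP : P ≤ pb) :
    a ^ P ≤ max 1 a ^ pb := by
  calc a ^ P ≤ max 1 a ^ P := by gcongr; exact le_max_right _ _
    _ ≤ _ := Real.rpow_le_rpow_of_exponent_le (le_max_left _ _) hP

lemma sobModular_bdd {N : ℕ} {s pb C : ℝ} {p : Euc N → Euc N → ℝ}
    (hpl : ∀ x y, 1 ≤ p x y) (hpu : ∀ x y, p x y ≤ pb) (hC : 0 ≤ C) {u : Euc N → ℝ}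
    (hu : sobModular Set.univ s p u < ⊤) (hn : sobNorm Set.univ s p u ≤ C) :
    sobModular Set.univ s p u ≤ ENNReal.ofReal ((C + 1) ^ pb) := by
  have hne : {c : ℝ | 0 < c ∧ sobModular Set.univ s p (fun x => u x / c) ≤ 1}.Nonempty := by
    set M := (sobModular Set.univ s p u).toReal with hM
    have hM0 : 0 ≤ M := ENNReal.toReal_nonneg
    refine ⟨M + 1, by positivity, ?_⟩
    have h1 := sobModular_scale (s := s) (p := p) (a := (M + 1)⁻¹) (L := (M + 1)⁻¹)
      (by positivity) (fun x y => by
        conv_rhs => rw [← Real.rpow_one (M + 1)⁻¹]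
        exact Real.rpow_le_rpow_of_exponent_ge (by positivity)
          (inv_le_one_of_one_le₀ (by linarith)) (hpl x y)) u
    have h2 : (fun x => u x / (M + 1)) = fun x => (M + 1)⁻¹ * u x := by
      funext x; rw [div_eq_inv_mul]
    rw [h2]
    refine h1.trans ?_
    rw [← ENNReal.ofReal_toReal hu.ne, ← hM, ← ENNReal.ofReal_mul (by positivity)]
    rw [← ENNReal.ofReal_one]
    apply ENNReal.ofReal_le_ofReal
    rw [inv_mul_le_iff₀ (by positivity)]; linarith
  have hlt : sInf {c : ℝ | 0 < c ∧ sobModular Set.univ s p (fun x => u x / c) ≤ 1} < C + 1 :=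
    lt_of_le_of_lt hn (by linarith)
  obtain ⟨c, ⟨hc0, hc⟩, hcC⟩ := exists_lt_of_csInf_lt hne hlt
  have h1 := sobModular_scale (s := s) (p := p) (a := c) (L := (C + 1) ^ pb) hc0.le
    (fun x y => (rpow_le_max hc0.le (by linarith [hpl x y]) (hpu x y)).trans (by
      have : 0 ≤ pb := by linarith [hpl 0 0, hpu 0 0]
      gcongr
      exact max_le (by linarith) hcC.le)) (fun x => u x / c)
  have h2 : (fun x => c * (u x / c)) = u := by
    funext x; field_simp
  rw [h2] at h1
  refine h1.trans ?_
  calc _ ≤ ENNReal.ofReal ((C + 1) ^ pb) * 1 := by gcongr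
    _ = _ := mul_one _

lemma Ufun_int {N : ℕ} {s pb : ℝ} {p : Euc N → Euc N → ℝ}
    (hp : Continuous fun z : Euc N × Euc N => p z.1 z.2) (hpd : ∀ x, p x x = pb)
    {u : Euc N → ℝ} (hu : AEMeasurable u volume)
    (hfin : sobModular Set.univ s p u < ⊤) (T : Set (Euc N)) :
    (∫⁻ x in T, (ENNReal.ofReal (|u x| ^ pb) + ∫⁻ y, sobKernel s p u x y)) ≤
      sobModular Set.univ s p u ∧
    ∫ x in T, Ufun s p pb u x =
      (∫⁻ x in T, (ENNReal.ofReal (|u x| ^ pb) + ∫⁻ y, sobKernel s p u x y)).toReal := by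
  have hm1 : AEMeasurable (fun x => ENNReal.ofReal (|u x| ^ pb)) volume :=
    ((continuous_abs.measurable.comp_aemeasurable hu).pow_const pb).ennreal_ofReal
  have hm2 : AEMeasurable (fun x => ∫⁻ y, sobKernel s p u x y) volume :=
    (sobKernel_aem s hp hu).lintegral_prod_right'
  have htot : ∫⁻ x, (ENNReal.ofReal (|u x| ^ pb) + ∫⁻ y, sobKernel s p u x y) =
      sobModular Set.univ s p u := by
    unfold sobModular
    simp only [Measure.restrict_univ, hpd]
    rw [lintegral_add_left' hm1]
  refine ⟨(setLIntegral_le_lintegral _ _).trans htot.le, ?_⟩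
  have hae : ∀ᵐ x, ENNReal.ofReal (|u x| ^ pb) + ∫⁻ y, sobKernel s p u x y < ⊤ :=
    ae_lt_top' (hm1.add hm2) (htot ▸ hfin.ne)
  have hm : AEMeasurable (fun x => ENNReal.ofReal (|u x| ^ pb) + ∫⁻ y, sobKernel s p u x y)
    volume := hm1.add hm2
  rw [← integral_toReal hm.restrict (ae_restrict_of_ae hae)]
  refine integral_congr_ae (ae_restrict_of_ae ?_)
  filter_upwards [hae] with x hx
  unfold Ufun
  rw [ENNReal.toReal_add ENNReal.ofReal_ne_top (by
    intro h; rw [h] at hx; simp at hx), ENNReal.toReal_ofReal (by positivity)]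

lemma limsup_nn {f : ℕ → ℝ} (hf : ∀ n, 0 ≤ f n) : 0 ≤ limsup f atTop := by
  rw [limsup_eq]
  apply Real.sInf_nonneg
  intro a ha
  obtain ⟨n, hn⟩ := (ha : ∀ᶠ n in atTop, f n ≤ a).exists
  exact (hf n).trans hn

lemma varModular_of_Sq {N : ℕ} {s c : ℝ} {p : Euc N → Euc N → ℝ} {q : Euc N → ℝ}
    (hq : ∀ x, 0 < q x) (hS : 0 < Sq s p q) (hc : 1 / Sq s p q < c) {v : Euc N → ℝ}
    (hv : AEStronglyMeasurable v volume) (hv1 : sobModular Set.univ s p v ≤ 1) :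
    varModular volume q (fun x => v x / c) ≤ 1 := by
  have hc0 : 0 < c := lt_trans (by positivity) hc
  by_cases hz : v =ᵐ[volume] 0
  · have : varModular volume q (fun x => v x / c) = 0 := by
      unfold varModular
      rw [lintegral_congr_ae (g := fun _ => 0)]
      · simp
      · filter_upwards [hz] with x hx
        simp [hx, Real.zero_rpow (hq x).ne']
    rw [this]; exact zero_le
  have hsob : sobNorm Set.univ s p v ≤ 1 := by
    apply csInf_le ⟨0, fun c hc => hc.1.le⟩
    exact ⟨one_pos, by simpa using hv1⟩
  have hle : Sq s p q ≤ sobNorm Set.univ s p v / luxNorm volume q v := by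
    apply csInf_le
    · refine ⟨0, ?_⟩
      rintro _ ⟨w, -, -, rfl⟩
      exact div_nonneg (Real.sInf_nonneg fun c hc => hc.1.le)
        (Real.sInf_nonneg fun c hc => hc.1.le)
    · exact ⟨v, ⟨by simpa using hv, hv1.trans_lt ENNReal.one_lt_top⟩, hz, rfl⟩
  have hlux0 : 0 ≤ luxNorm volume q v := Real.sInf_nonneg fun c hc => hc.1.le
  have hlux : 0 < luxNorm volume q v := by
    refine lt_of_le_of_ne hlux0 fun h => ?_
    rw [← h, div_zero] at hle
    linarith
  have hlc : luxNorm volume q v < c := by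
    rw [le_div_iff₀ hlux] at hle
    refine lt_of_le_of_lt ?_ hc
    rw [le_div_iff₀ hS]
    linarith
  have hne : {c : ℝ | 0 < c ∧ varModular volume q (fun x => v x / c) ≤ 1}.Nonempty := by
    by_contra h
    rw [Set.not_nonempty_iff_eq_empty] at h
    unfold luxNorm at hlux
    rw [h, Real.sInf_empty] at hlux
    exact lt_irrefl _ hlux
  obtain ⟨b, ⟨hb0, hb⟩, hbc⟩ := exists_lt_of_csInf_lt hne hlc
  refine le_trans (lintegral_mono fun x => ENNReal.ofReal_le_ofReal ?_) hb
  have := hq x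
  rw [abs_div, abs_div, abs_of_pos hc0, abs_of_pos hb0]
  gcongr
/-- Theorem 4.3, second part: the relation between the masses at
infinity, under the condition (E_∞). -/
theorem ccp_at_infinity_inequality {N : ℕ}
    (s pminus pbar ε₀ : ℝ) (hs : s ∈ Set.Ioo (0 : ℝ) 1)
    (p : Euc N → Euc N → ℝ) (pstar : Euc N → ℝ)
    (hpuc : UniformContinuous fun z : Euc N × Euc N => p z.1 z.2)
    (hpsym : ∀ x y, p x y = p y x)
    (hpminus : IsGLB (Set.range fun z : Euc N × Euc N => p z.1 z.2) pminus)
    (hpbar : IsLUB (Set.range fun z : Euc N × Euc N => p z.1 z.2) pbar)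
    (hpm1 : 1 < pminus) (hpbarN : pbar < (N : ℝ) / s)
    (hε₀ : ε₀ ∈ Set.Ioo (0 : ℝ) (1 / 2))
    (hdiag : ∀ x y : Euc N, dist x y < ε₀ → p x y = pbar)
    (hsupx : ∀ x : Euc N, IsLUB (Set.range (p x)) pbar)
    (hpstar : ∀ x : Euc N, IsGLB (Set.range (p x)) (pstar x))
    (hfin : volume {x : Euc N | pstar x ≠ pbar} < ⊤)
    (q : Euc N → ℝ) (hquc : UniformContinuous q)
    (pbarS : ℝ) (hpbarS : pbarS = (N : ℝ) * pbar / ((N : ℝ) - s * pbar))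
    (hqlb : ∀ x, pstar x ≤ q x) (hqub : ∀ x, q x ≤ pbarS)
    (hqcrit : {x : Euc N | q x = pbarS}.Nonempty)
    (un : ℕ → Euc N → ℝ) (u : Euc N → ℝ)
    (hmem : ∀ n, MemSob Set.univ s p (un n)) (humem : MemSob Set.univ s p u)
    (hbdd : ∃ C : ℝ, ∀ n, sobNorm Set.univ s p (un n) ≤ C)
    (hweak : WeakConvSob s p un u)
    (μ ν : Measure (Euc N)) (hμfin : IsFiniteMeasure μ) (hνfin : IsFiniteMeasure ν)
    (hμ : WeakStarConv (fun n => Ufun s p pbar (un n)) μ)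
    (hν : WeakStarConv (fun n x => |un n x| ^ q x) ν)
    (qinf : ℝ) (hqinf1 : 1 < qinf)
    (hpinf : Tendsto (fun z : Euc N × Euc N => p z.1 z.2)
      ((cocompact (Euc N)) ×ˢ (cocompact (Euc N))) (𝓝 pbar))
    (hqinf : Tendsto q (cocompact (Euc N)) (𝓝 qinf))
    (νinf μinf : ℝ)
    (hνinf : Tendsto (fun R : ℝ => limsup
        (fun n => ∫ x in {x : Euc N | R < ‖x‖}, |un n x| ^ q x) atTop)
      atTop (𝓝 νinf))
    (hμinf : Tendsto (fun R : ℝ => limsup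
        (fun n => ∫ x in {x : Euc N | R < ‖x‖}, Ufun s p pbar (un n) x) atTop)
      atTop (𝓝 μinf)) :
    Sq s p q * νinf ^ (1 / qinf) ≤ μinf ^ (1 / pbar) := by
  have hpl : ∀ x y, pminus ≤ p x y := fun x y => hpminus.1 ⟨(x, y), rfl⟩
  have hpu : ∀ x y, p x y ≤ pbar := fun x y => hpbar.1 ⟨(x, y), rfl⟩
  have hpd : ∀ x, p x x = pbar := fun x => hdiag x x (by rw [dist_self]; exact hε₀.1)
  have hpb1 : 1 < pbar := by linarith [hpl 0 0, hpu 0 0]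
  have hpb0 : 0 < pbar := by linarith
  have hN : 0 < N := by
    rcases Nat.eq_zero_or_pos N with h | h
    · rw [h] at hpbarN
      simp at hpbarN
      linarith
    · exact h
  have hpc := hpuc.continuous
  have hq1 : ∀ x, 1 < q x := fun x =>
    lt_of_lt_of_le (lt_of_lt_of_le hpm1 ((hpstar x).2 (by rintro _ ⟨y, rfl⟩; exact hpl x y)))
      (hqlb x)
  -- the exceptional set
  set A : Set (Euc N) := {x | pstar x ≠ pbar} with hAdef
  have hAp : ∀ x y, x ∉ A → p x y = pbar := by
    intro x y hx
    have hx' : pstar x = pbar := not_not.1 hx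
    exact le_antisymm (hpu x y) (hx' ▸ (hpstar x).1 ⟨y, rfl⟩)
  have hAm : MeasurableSet A := by
    have hAe : A = ⋃ y, {x | p x y < pbar} := by
      ext x
      simp only [Set.mem_iUnion, Set.mem_ofPred_eq]
      constructor
      · intro hx
        by_contra hcon
        push Not at hcon
        apply hx
        have h1 : pbar ≤ pstar x := (hpstar x).2 (by rintro _ ⟨y, rfl⟩; exact hcon y)
        exact le_antisymm (((hpstar x).1 ⟨x, rfl⟩).trans (hpu x x)) h1
      · rintro ⟨y, hy⟩ hx
        have := (hpstar x).1 ⟨y, rfl⟩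
        rw [hx] at this
        exact absurd hy (not_lt.2 this)
    rw [hAe]
    refine (isOpen_iUnion fun y => isOpen_lt ?_ continuous_const).measurableSet
    exact hpc.comp (continuous_id.prodMk continuous_const)
  -- uniform bounds
  obtain ⟨C', hC'⟩ := hbdd
  set C := max C' 0 with hCdef
  have hC0 : 0 ≤ C := le_max_right _ _
  set M0 : ℝ := (C + 1) ^ pbar with hM0
  have hM00 : 0 ≤ M0 := by positivity
  have hMod : ∀ n, sobModular Set.univ s p (un n) ≤ ENNReal.ofReal M0 := fun n =>
    sobModular_bdd (fun x y => by linarith [hpl x y]) hpu hC0 (hmem n).2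
      ((hC' n).trans (le_max_left _ _))
  have hum : ∀ n, AEMeasurable (un n) volume := fun n => by
    have := (hmem n).1.aemeasurable
    rwa [Measure.restrict_univ] at this
  have hUle : ∀ n (T : Set (Euc N)), ∫ x in T, Ufun s p pbar (un n) x ≤ M0 := by
    intro n T
    obtain ⟨h1, h2⟩ := Ufun_int hpc hpd (hum n) (hmem n).2 T
    rw [h2]
    exact ENNReal.toReal_le_of_le_ofReal hM00 (h1.trans (hMod n))
  have hμ0 : 0 ≤ μinf := by
    refine ge_of_tendsto' hμinf fun R => limsup_nn fun n => integral_nonneg fun x => ?_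
    unfold Ufun
    positivity
  have hν0 : 0 ≤ νinf := by
    refine ge_of_tendsto' hνinf fun R => limsup_nn fun n => integral_nonneg fun x => ?_
    positivity
  have hS0 : 0 ≤ Sq s p q := by
    apply Real.sInf_nonneg
    rintro _ ⟨w, -, -, rfl⟩
    exact div_nonneg (Real.sInf_nonneg fun c hc => hc.1.le)
      (Real.sInf_nonneg fun c hc => hc.1.le)
  rcases hS0.eq_or_lt with hS | hS
  · rw [← hS, zero_mul]; positivity
  have main : ∀ l : ℝ, 0 < l → l ^ pbar * μinf < 1 → ∀ c, 1 / Sq s p q < c → ∀ η, 0 < η →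
      νinf ≤ (c / l) ^ qinf + η := by
    intro l hl hlμ c hc η hη
    have hc0 : 0 < c := lt_trans (by positivity) hc
    obtain ⟨t, ht0, ht1, htF⟩ : ∃ t : ℝ, 0 < t ∧ t < 1 ∧
        (1 - t) ^ (-pbar) * (l ^ pbar + t) * (μinf + t) < 1 := by
      have hcont : ContinuousAt
          (fun t : ℝ => (1 - t) ^ (-pbar) * (l ^ pbar + t) * (μinf + t)) 0 := by
        have h1 : ContinuousAt (fun t : ℝ => (1 - t) ^ (-pbar)) 0 := by
          apply ContinuousAt.rpow_const
          · fun_prop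
          · left; norm_num
        exact (h1.mul (by fun_prop)).mul (by fun_prop)
      have hlt : ∀ᶠ t in 𝓝 (0 : ℝ), (1 - t) ^ (-pbar) * (l ^ pbar + t) * (μinf + t) < 1 := by
        apply hcont.eventually_lt_const
        simpa using hlμ
      have h2 : ∀ᶠ t in 𝓝[>] (0 : ℝ), t < 1 :=
        nhdsWithin_le_nhds (eventually_lt_nhds one_pos)
      have hlt' : ∀ᶠ t in 𝓝[>] (0 : ℝ),
          (1 - t) ^ (-pbar) * (l ^ pbar + t) * (μinf + t) < 1 := nhdsWithin_le_nhds hlt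
      obtain ⟨t, h, h', h''⟩ := (hlt'.and
        (h2.and (self_mem_nhdsWithin (a := (0:ℝ)) (s := Ioi 0)))).exists
      exact ⟨t, h'', h', h⟩
    set κ := l ^ pbar + t with hκ
    set c0 := (1 - t) ^ (-pbar) * κ with hc0def
    have h1t : 0 < 1 - t := by linarith
    have hc00 : 0 ≤ c0 := by positivity
    set D := (1 - t) ^ (-pbar) * (max 1 l ^ pbar) * (2 ^ pbar * 2 ^ pbar) +
      t ^ (-pbar) * (max 1 l ^ pbar) with hD
    -- eventual conditions in R
    have e1 : ∀ᶠ R : ℝ in atTop, ENNReal.ofReal D * (2 * (ENNReal.ofReal M0 + volume A) *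
        ∫⁻ z : Euc N, ENNReal.ofReal (gKer s pminus R z)) < ENNReal.ofReal (1 - c0 * (μinf + t)) := by
      have hk := gKer_tendsto hN s pminus hs (by linarith)
      have h2 : 2 * (ENNReal.ofReal M0 + volume A) ≠ ⊤ :=
        ENNReal.mul_ne_top (by simp) (ENNReal.add_ne_top.2 ⟨ENNReal.ofReal_ne_top, hfin.ne⟩)
      have h3 := ENNReal.Tendsto.const_mul (ENNReal.Tendsto.const_mul hk (Or.inr h2))
        (Or.inr (ENNReal.ofReal_ne_top (r := D)))
      simp only [mul_zero] at h3
      refine h3.eventually_lt_const ?_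
      rw [ENNReal.ofReal_pos]; linarith
    have e2 : ∀ᶠ R : ℝ in atTop, limsup
        (fun n => ∫ x in {x : Euc N | R < ‖x‖}, Ufun s p pbar (un n) x) atTop < μinf + t :=
      hμinf.eventually_lt_const (by linarith)
    have e3 : ∀ᶠ R : ℝ in atTop, ∀ x y : Euc N, R / 2 < ‖x‖ → R / 2 < ‖y‖ → l ^ p x y ≤ κ := by
      have h1 : Tendsto (fun z : Euc N × Euc N => l ^ p z.1 z.2)
          ((cocompact (Euc N)) ×ˢ (cocompact (Euc N))) (𝓝 (l ^ pbar)) :=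
        (tendsto_const_nhds (x := l)).rpow hpinf (Or.inl hl.ne')
      have h2 := h1.eventually_lt_const (show l ^ pbar < κ by linarith)
      rw [← Metric.cobounded_eq_cocompact] at h2
      have hb := (hasBasis_cobounded_norm (E := Euc N)).prod_self
      obtain ⟨r, -, hr⟩ := hb.eventually_iff.1 h2
      filter_upwards [eventually_ge_atTop (2 * r)] with R hR x y hx hy
      have hxy : (x, y) ∈ {x : Euc N | r ≤ ‖x‖} ×ˢ {x : Euc N | r ≤ ‖x‖} :=
        ⟨show r ≤ ‖x‖ by linarith, show r ≤ ‖y‖ by linarith⟩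
      exact (hr hxy).le
    have e4 : ∀ᶠ R : ℝ in atTop, ∀ x : Euc N, 2 * R < ‖x‖ →
        (c / l) ^ q x ≤ (c / l) ^ qinf + η := by
      have h1 : Tendsto (fun x : Euc N => (c / l) ^ q x) (cocompact (Euc N))
          (𝓝 ((c / l) ^ qinf)) :=
        (tendsto_const_nhds (x := c / l)).rpow hqinf (Or.inl (by positivity))
      have h2 := h1.eventually_lt_const (show (c / l) ^ qinf < (c / l) ^ qinf + η by linarith)
      rw [← Metric.cobounded_eq_cocompact] at h2
      obtain ⟨r, -, hr⟩ := (hasBasis_cobounded_norm (E := Euc N)).eventually_iff.1 h2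
      filter_upwards [eventually_ge_atTop r, eventually_ge_atTop 0] with R hR hR0 x hx
      exact (hr (show r ≤ ‖x‖ by linarith)).le
    have hν2 : Tendsto (fun R : ℝ => limsup
        (fun n => ∫ x in {x : Euc N | 2 * R < ‖x‖}, |un n x| ^ q x) atTop) atTop (𝓝 νinf) :=
      hνinf.comp (tendsto_id.const_mul_atTop (by norm_num : (0:ℝ) < 2))
    refine le_of_tendsto hν2 ?_
    filter_upwards [e1, e2, e3, e4, eventually_ge_atTop 1] with R h1 h2 h3 h4 hR
    have hR0 : 0 < R := by linarith
    refine limsup_le_of_le (isCoboundedUnder_le_of_le atTop (x := 0)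
      fun n => integral_nonneg fun x => by positivity) ?_
    have hbd : IsBoundedUnder (· ≤ ·) atTop
        (fun n => ∫ x in {x : Euc N | R < ‖x‖}, Ufun s p pbar (un n) x) :=
      isBoundedUnder_of ⟨M0, fun n => hUle n _⟩
    filter_upwards [eventually_lt_of_limsup_lt h2 hbd] with n hn
    have hmod : sobModular Set.univ s p (fun x => cut R x * un n x * l) ≤ 1 := by
      have hm := mod_cut (L := max 1 l ^ pbar) hs hpm1 hpl hpu hpsym hpd hAm hAp hR hl ht0 ht1
        (fun x y => rpow_le_max hl.le (by linarith [hpl x y]) (hpu x y))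
        (show l ^ pbar ≤ κ by linarith) h3 (hum n)
      rw [← hc0def, ← hD] at hm
      obtain ⟨hu1, hu2⟩ := Ufun_int hpc hpd (hum n) (hmem n).2 {x : Euc N | R < ‖x‖}
      have hfinU := hu1.trans_lt (hmem n).2
      have hup : ∫⁻ x, ENNReal.ofReal (|un n x| ^ pbar) ≤ ENNReal.ofReal M0 := by
        refine le_trans ?_ (hMod n)
        unfold sobModular
        simp only [Measure.restrict_univ, hpd]
        exact le_self_add
      have hI : (∫⁻ x in {x : Euc N | R < ‖x‖},
          (ENNReal.ofReal (|un n x| ^ pbar) + ∫⁻ y, sobKernel s p (un n) x y)) ≤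
          ENNReal.ofReal (μinf + t) := by
        rw [← ENNReal.ofReal_toReal hfinU.ne, ← hu2]
        exact ENNReal.ofReal_le_ofReal hn.le
      calc _ ≤ _ := hm
        _ ≤ ENNReal.ofReal c0 * ENNReal.ofReal (μinf + t) +
            ENNReal.ofReal D * (2 * (ENNReal.ofReal M0 + volume A) *
              ∫⁻ z : Euc N, ENNReal.ofReal (gKer s pminus R z)) := by gcongr
        _ ≤ ENNReal.ofReal c0 * ENNReal.ofReal (μinf + t) +
            ENNReal.ofReal (1 - c0 * (μinf + t)) := by gcongr
        _ = 1 := by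
          rw [← ENNReal.ofReal_mul hc00, ← ENNReal.ofReal_add (by positivity) (by linarith)]
          simp
    have hvm : AEStronglyMeasurable (fun x => cut R x * un n x * l) volume :=
      (((cut_cont R).measurable.aemeasurable.mul (hum n)).mul_const l).aestronglyMeasurable
    have hvar := varModular_of_Sq (fun x => by linarith [hq1 x]) hS hc hvm hmod
    have hTm : MeasurableSet {x : Euc N | 2 * R < ‖x‖} :=
      measurableSet_lt measurable_const measurable_norm
    have hqm : AEMeasurable (fun x => |un n x| ^ q x) volume :=
      (continuous_abs.measurable.comp_aemeasurable (hum n)).pow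
        hquc.continuous.measurable.aemeasurable
    have hK0 : 0 ≤ (c / l) ^ qinf + η := by positivity
    rw [integral_eq_lintegral_of_nonneg_ae (Eventually.of_forall fun x => by positivity)
      hqm.aestronglyMeasurable.restrict]
    refine ENNReal.toReal_le_of_le_ofReal hK0 ?_
    calc ∫⁻ x in {x : Euc N | 2 * R < ‖x‖}, ENNReal.ofReal (|un n x| ^ q x)
        ≤ ∫⁻ x in {x : Euc N | 2 * R < ‖x‖}, ENNReal.ofReal ((c / l) ^ qinf + η) *
            ENNReal.ofReal (|cut R x * un n x * l / c| ^ q x) := by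
          refine setLIntegral_mono' hTm fun x hx => ?_
          have hx' : 2 * R < ‖x‖ := hx
          rw [← ENNReal.ofReal_mul hK0]
          apply ENNReal.ofReal_le_ofReal
          rw [cut_one hR0 hx'.le, one_mul]
          have e : |un n x| = (c / l) * |un n x * l / c| := by
            rw [abs_div, abs_mul, abs_of_pos hl, abs_of_pos hc0]
            field_simp
          conv_lhs => rw [e]
          rw [Real.mul_rpow (by positivity) (abs_nonneg _)]
          have := h4 x hx'
          gcongr
      _ ≤ ∫⁻ x, ENNReal.ofReal ((c / l) ^ qinf + η) *
            ENNReal.ofReal (|cut R x * un n x * l / c| ^ q x) := setLIntegral_le_lintegral _ _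
      _ = ENNReal.ofReal ((c / l) ^ qinf + η) *
            varModular volume q (fun x => cut R x * un n x * l / c) := by
          rw [lintegral_const_mul' _ _ ENNReal.ofReal_ne_top]; rfl
      _ ≤ ENNReal.ofReal ((c / l) ^ qinf + η) * 1 := by gcongr
      _ = _ := mul_one _
  -- conclusion
  have hqi : 0 < qinf := by linarith
  refine le_of_forall_gt_imp_ge_of_dense fun lam hlam => ?_
  have hlam0 : 0 < lam := lt_of_le_of_lt (by positivity) hlam
  have hlamμ : lam⁻¹ ^ pbar * μinf < 1 := by
    have h1 : μinf < lam ^ pbar := by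
      have := Real.rpow_lt_rpow (by positivity) hlam hpb0
      rwa [← Real.rpow_mul hμ0, one_div_mul_cancel hpb0.ne', Real.rpow_one] at this
    rw [Real.inv_rpow hlam0.le, inv_mul_lt_iff₀ (by positivity)]
    linarith
  have h2 : ∀ c, 1 / Sq s p q < c → νinf ^ (1 / qinf) ≤ c * lam := by
    intro c hc
    have hc0 : 0 < c := lt_trans (by positivity) hc
    have h3 : νinf ≤ (c / lam⁻¹) ^ qinf :=
      le_of_forall_pos_le_add fun η hη => main lam⁻¹ (by positivity) hlamμ c hc η hη
    have h4 : νinf ^ (1 / qinf) ≤ ((c / lam⁻¹) ^ qinf) ^ (1 / qinf) := by gcongr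
    rwa [← Real.rpow_mul (by positivity), mul_one_div_cancel hqi.ne', Real.rpow_one,
      div_inv_eq_mul] at h4
  have h5 : νinf ^ (1 / qinf) / lam ≤ 1 / Sq s p q := by
    refine le_of_forall_gt_imp_ge_of_dense fun c hc => ?_
    rw [div_le_iff₀ hlam0]
    exact h2 c hc
  rw [div_le_div_iff₀ hlam0 hS] at h5
  linarith
end
end
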